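/- arXiv:1305.2571 — 11 statements merged into one kernel-verified Lean document; each statement's English description precedes it below -/
import Mathlib

section
/- Let E be a real Banach space and let Φ : E → ℝ be continuously Fréchet differentiable with Φ(0) = 0. Suppose there exist ρ, τ > 0 and e ∈ E with ‖e‖ > ρ such that Φ(u) ≥ τ for every u ∈ E with ‖u‖ = ρ, and Φ(e) ≤ 0. Let Γ = {γ ∈ C([0,1]; E) : γ(0) = 0 and γ(1) = e} and c = inf_{γ∈Γ} max_{t∈[0,1]} Φ(γ(t)). Then c ≥ τ and there exists a sequence (u_k) in E such that Φ(u_k) → c and ‖Φ'(u_k)‖_{E*} → 0 (a Palais–Smale sequence at level c). -/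
/-- Ekeland's variational principle. -/
theorem LowerSemicontinuous.exists_ekeland {X : Type*} [MetricSpace X] [CompleteSpace X]
    {F : X → ℝ} (hF : LowerSemicontinuous F) (hbdd : BddBelow (Set.range F))
    {ε : ℝ} (hε : 0 < ε) (x₀ : X) :
    ∃ x, F x ≤ F x₀ ∧ ∀ y, F x ≤ F y + ε * dist x y := by
  let S : X → Set X := fun x => {y | F y + ε * dist x y ≤ F x}
  have self_mem : ∀ x, x ∈ S x := fun x => by simp [S]
  have S_trans : ∀ {x y}, y ∈ S x → S y ⊆ S x := by
    intro x y hy z hz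
    simp only [S, Set.mem_ofPred_eq] at hy hz ⊢
    nlinarith [dist_triangle x y z]
  have S_closed : ∀ x, IsClosed (S x) := fun x =>
    (hF.add (Continuous.lowerSemicontinuous
      (f := fun y => ε * dist x y) (by fun_prop))).isClosed_preimage (F x)
  have step : ∀ (n : ℕ) (x : X), ∃ y ∈ S x, ∀ z ∈ S x, F y ≤ F z + (1 / 2 : ℝ) ^ n := by
    intro n x
    have hb : BddBelow (F '' S x) := hbdd.mono (Set.image_subset_range _ _)
    obtain ⟨_, ⟨y, hy, rfl⟩, hlt⟩ := Real.lt_sInf_add_pos (s := F '' S x)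
      ⟨_, Set.mem_image_of_mem F (self_mem x)⟩ (ε := (1 / 2 : ℝ) ^ n) (by positivity)
    exact ⟨y, hy, fun z hz => hlt.le.trans
      (add_le_add_left (csInf_le hb (Set.mem_image_of_mem F hz)) _)⟩
  choose next next_mem next_le using step
  let u : ℕ → X := fun n => Nat.rec x₀ next n
  have u_anti : Antitone fun n => S (u n) :=
    antitone_nat_of_succ_le fun n => S_trans (next_mem n (u n))
  have dist_le : ∀ n, ∀ z ∈ S (u (n + 1)), dist (u (n + 1)) z ≤ (1 / ε) * (1 / 2 : ℝ) ^ n := by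
    intro n z hz
    have h₁ := next_le n (u n) z (u_anti n.le_succ hz)
    have h₂ : F z + ε * dist (u (n + 1)) z ≤ F (u (n + 1)) := hz
    have h₃ : F (u (n + 1)) ≤ F z + (1 / 2 : ℝ) ^ n := h₁
    rw [one_div, ← div_eq_inv_mul, le_div_iff₀ hε]
    linarith
  have bound_tendsto : Filter.Tendsto (fun n : ℕ => (1 / ε) * (1 / 2 : ℝ) ^ n)
      Filter.atTop (nhds 0) := by
    simpa using (tendsto_pow_atTop_nhds_zero_of_lt_one (r := (1 / 2 : ℝ))
      (by norm_num) (by norm_num)).const_mul (1 / ε)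
  have u_mem : ∀ {m n}, m ≤ n → u n ∈ S (u m) := fun h => u_anti h (self_mem _)
  have cauchy : CauchySeq fun n => u (n + 1) :=
    cauchySeq_of_le_tendsto_0' _ (fun n m h => dist_le n _ (u_mem (Nat.succ_le_succ h))) bound_tendsto
  obtain ⟨x, hx⟩ := cauchySeq_tendsto_of_complete cauchy
  have x_mem : ∀ n, x ∈ S (u n) := fun n =>
    (S_closed (u n)).mem_of_tendsto hx (Filter.eventually_atTop.2
      ⟨n, fun m hm => u_mem (Nat.le_succ_of_le hm)⟩)
  refine ⟨x, ?_, fun y => ?_⟩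
  · have h : F x + ε * dist x₀ x ≤ F x₀ := x_mem 0
    nlinarith [dist_nonneg (x := x₀) (y := x)]
  · by_contra! hy
    have hyx : Filter.Tendsto (fun n => u (n + 1)) Filter.atTop (nhds y) :=
      tendsto_iff_dist_tendsto_zero.2 (squeeze_zero (fun _ => dist_nonneg)
        (fun n => dist_le n y (S_trans (x_mem (n + 1)) hy.le)) bound_tendsto)
    obtain rfl := tendsto_nhds_unique hx hyx
    simp at hy

theorem ContinuousLinearMap.exists_lt_apply_of_lt_norm {E : Type*} [NormedAddCommGroup E]
    [NormedSpace ℝ E] (f : E →L[ℝ] ℝ) {r : ℝ} (hr : r < ‖f‖) :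
    ∃ v : E, ‖v‖ ≤ 1 ∧ r < f v := by
  obtain ⟨v, hv, h⟩ := f.exists_lt_apply_of_lt_opNorm hr
  rcases lt_abs.1 h with h | h
  · exact ⟨v, hv.le, h⟩
  · exact ⟨-v, by simpa using hv.le, by simpa using h⟩

section

variable {K E : Type*} [TopologicalSpace K] [CompactSpace K] [NormedAddCommGroup E]

theorem ContinuousMap.bddAbove_range_comp {Φ : E → ℝ} (hΦ : Continuous Φ) (γ : C(K, E)) :
    BddAbove (Set.range fun t => Φ (γ t)) :=
  (isCompact_range (hΦ.comp γ.continuous)).bddAbove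

theorem ContinuousMap.exists_eq_iSup_comp [Nonempty K] {Φ : E → ℝ} (hΦ : Continuous Φ)
    (γ : C(K, E)) : ∃ t, Φ (γ t) = ⨆ s, Φ (γ s) :=
  (isCompact_range (hΦ.comp γ.continuous)).sSup_mem (Set.range_nonempty _)

theorem ContinuousMap.lowerSemicontinuous_iSup_comp {Φ : E → ℝ} (hΦ : Continuous Φ) :
    LowerSemicontinuous fun γ : C(K, E) => ⨆ t, Φ (γ t) :=
  lowerSemicontinuous_ciSup (ContinuousMap.bddAbove_range_comp hΦ)
    fun t => (hΦ.comp (continuous_eval_const t)).lowerSemicontinuous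

end

/-- A continuous family of functionals of norm greater than `ε` on a closed set `A` admits a
continuous field in the unit ball, vanishing on a closed set `B` disjoint from `A`, on which the
functionals exceed `ε` at every point of `A`. -/
theorem exists_continuous_ascent_field {K E : Type*} [MetricSpace K]
    [NormedAddCommGroup E] [NormedSpace ℝ E] {L : K → (E →L[ℝ] ℝ)} (hL : Continuous L)
    {A B : Set K} (hA : IsClosed A) (hB : IsClosed B) (hAB : Disjoint A B) {ε : ℝ}
    (hε : ∀ t ∈ A, ε < ‖L t‖) :
    ∃ v : C(K, E), (∀ t, ‖v t‖ ≤ 1) ∧ (∀ t ∈ A, ε < L t (v t)) ∧ ∀ t ∈ B, v t = 0 := by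
  let T : K → Set E := fun t => {v | ‖v‖ ≤ 1 ∧ (t ∈ A → ε < L t v) ∧ (t ∈ B → v = 0)}
  have hT : ∀ t, Convex ℝ (T t) := by
    intro t x hx y hy a b ha hb hab
    refine ⟨?_, fun ht => ?_, fun ht => by simp [hx.2.2 ht, hy.2.2 ht]⟩
    · have := convex_closedBall (0 : E) 1 (x := x) (by simpa using hx.1)
        (y := y) (by simpa using hy.1) ha hb hab
      simpa using this
    · exact (convex_halfSpace_gt (L t).isLinear ε) (hx.2.1 ht) (hy.2.1 ht) ha hb hab
  obtain ⟨v, hv⟩ := exists_continuous_forall_mem_convex_of_local_const hT (fun t => by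
    by_cases ht : t ∈ A
    · obtain ⟨w, hw, hlt⟩ := (L t).exists_lt_apply_of_lt_norm (hε t ht)
      refine ⟨w, ?_⟩
      have hcont : Continuous fun s => L s w := by fun_prop
      filter_upwards [hcont.continuousAt.eventually (lt_mem_nhds hlt),
        hB.isOpen_compl.mem_nhds (Set.disjoint_left.1 hAB ht)] with s hs hsB
      exact ⟨hw, fun _ => hs, fun h => absurd h hsB⟩
    · refine ⟨0, ?_⟩
      filter_upwards [hA.isOpen_compl.mem_nhds ht] with s hs
      exact ⟨by simp, fun h => absurd h hs, fun _ => rfl⟩)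
  exact ⟨v, fun t => (hv t).1, fun t => (hv t).2.1, fun t => (hv t).2.2⟩

/-- If `γ` almost minimizes `⨆ t, Φ (γ t)` among maps with the same values on `B`, then `Φ'` is
small at some maximum point of `Φ` along `γ`. -/
theorem exists_norm_fderiv_le_of_almost_minimal {K E : Type*} [MetricSpace K] [CompactSpace K]
    [Nonempty K] [NormedAddCommGroup E] [NormedSpace ℝ E] {Φ : E → ℝ} {Φ' : E → (E →L[ℝ] ℝ)}
    (hderiv : ∀ u : E, HasFDerivAt Φ (Φ' u) u) (hcont : Continuous Φ')
    {B : Set K} (hB : IsClosed B) (γ : C(K, E)) {ε : ℝ} (hε : 0 < ε)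
    (hγB : ∀ t ∈ B, Φ (γ t) < ⨆ s, Φ (γ s))
    (hmin : ∀ η : C(K, E), Set.EqOn η γ B →
      ⨆ t, Φ (γ t) ≤ (⨆ t, Φ (η t)) + ε * dist γ η) :
    ∃ t, Φ (γ t) = ⨆ s, Φ (γ s) ∧ ‖Φ' (γ t)‖ ≤ ε := by
  have hΦ : Continuous Φ := continuous_iff_continuousAt.2 fun u => (hderiv u).continuousAt
  by_contra! hlt
  obtain ⟨v, hv_norm, hvA, hvB⟩ := exists_continuous_ascent_field
    (L := fun t => Φ' (γ t)) (by fun_prop) (A := {t | Φ (γ t) = ⨆ s, Φ (γ s)})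
    (isClosed_eq (by fun_prop) continuous_const) hB
    (Set.disjoint_left.2 fun t ht htB => (hγB t htB).ne ht) hlt
  have key : ∀ h : ℝ, 0 < h → ∃ t : K, ∃ s ∈ Set.Ioo 0 h,
      (⨆ r, Φ (γ r)) ≤ Φ (γ t - h • v t) + ε * h ∧ Φ' (γ t - s • v t) (v t) ≤ ε := by
    intro h hh
    obtain ⟨t, ht⟩ := ContinuousMap.exists_eq_iSup_comp hΦ (γ - h • v)
    have hdist : dist γ (γ - h • v) ≤ h := by
      refine (ContinuousMap.dist_le hh.le).2 fun r => ?_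
      simpa [dist_eq_norm, norm_smul, abs_of_pos hh] using
        mul_le_mul_of_nonneg_left (hv_norm r) hh.le
    have hm := hmin (γ - h • v) fun r hr => by simp [hvB r hr]
    rw [← ht] at hm
    have hle : (⨆ r, Φ (γ r)) ≤ Φ (γ t - h • v t) + ε * h :=
      hm.trans (by simpa using mul_le_mul_of_nonneg_left hdist hε.le)
    have hd : ∀ s : ℝ, HasDerivAt (fun s : ℝ => Φ (γ t - s • v t))
        (Φ' (γ t - s • v t) (-v t)) s := fun s => by
      have := ((hasDerivAt_id s).smul_const (v t)).const_sub (γ t)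
      exact (hderiv _).comp_hasDerivAt s (by simpa using this)
    obtain ⟨s, hs, hs'⟩ := exists_hasDerivAt_eq_slope _ _ hh
      (fun s _ => (hd s).continuousAt.continuousWithinAt) (fun s _ => hd s)
    refine ⟨t, s, hs, hle, ?_⟩
    have hγt := le_ciSup (ContinuousMap.bddAbove_range_comp hΦ γ) t
    rw [eq_div_iff (by simpa using hh.ne')] at hs'
    simp only [map_neg, zero_smul, sub_zero] at hs'
    refine le_of_mul_le_mul_right ?_ hh
    linarith
  choose t s hs hsup hder using fun n : ℕ => key (1 / ((n : ℝ) + 1)) Nat.one_div_pos_of_nat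
  obtain ⟨a, -, φ, hφ, ha⟩ := isCompact_univ.tendsto_subseq fun n => Set.mem_univ (t n)
  have h_lim : Filter.Tendsto (fun n => 1 / ((φ n : ℝ) + 1)) Filter.atTop (nhds 0) :=
    tendsto_one_div_add_atTop_nhds_zero_nat.comp hφ.tendsto_atTop
  have s_lim : Filter.Tendsto (fun n => s (φ n)) Filter.atTop (nhds 0) :=
    squeeze_zero (fun n => (hs _).1.le) (fun n => (hs _).2.le) h_lim
  have γ_lim := (γ.continuous.tendsto a).comp ha
  have v_lim := (v.continuous.tendsto a).comp ha
  have ha_max : Φ (γ a) = ⨆ r, Φ (γ r) := by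
    refine le_antisymm (le_ciSup (ContinuousMap.bddAbove_range_comp hΦ γ) a) ?_
    have hl := ((hΦ.tendsto _).comp (γ_lim.sub (h_lim.smul v_lim))).add (h_lim.const_mul ε)
    simp only [zero_smul, sub_zero, mul_zero, add_zero] at hl
    exact ge_of_tendsto' hl fun n => hsup (φ n)
  have hder_cont : Continuous fun p : ℝ × K => Φ' (γ p.2 - p.1 • v p.2) (v p.2) :=
    Continuous.clm_apply (by fun_prop) (by fun_prop)
  have hl := (hder_cont.tendsto (0, a)).comp (s_lim.prodMk_nhds ha)
  simp only [zero_smul, sub_zero] at hl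
  exact (hvA a ha_max).not_ge (le_of_tendsto' hl fun n => hder (φ n))

/-- The values of `sSup` along paths on the real line are those of `iSup` along bundled paths. -/
theorem setOf_sSup_path_eq_range {E : Type*} [NormedAddCommGroup E] (Φ : E → ℝ) (x y : E) :
    {a : ℝ | ∃ γ : ℝ → E, ContinuousOn γ (Set.Icc 0 1) ∧
      γ 0 = x ∧ γ 1 = y ∧ a = sSup ((fun t => Φ (γ t)) '' Set.Icc 0 1)} =
    Set.range fun γ : {γ : C(unitInterval, E) // γ 0 = x ∧ γ 1 = y} => ⨆ t, Φ (γ.1 t) := by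
  ext a
  constructor
  · rintro ⟨γ, hγ, h0, h1, rfl⟩
    exact ⟨⟨⟨_, hγ.domRestrict⟩, h0, h1⟩, by
      rw [Set.image_eq_range]; rfl⟩
  · rintro ⟨⟨γ, h0, h1⟩, rfl⟩
    refine ⟨Set.IccExtend zero_le_one γ, γ.continuous.Icc_extend'.continuousOn, ?_, ?_, ?_⟩
    · simpa using h0
    · simpa using h1
    · rw [Set.image_eq_range]
      exact congrArg sSup (congrArg Set.range (funext fun t => by simp))


/-- Mountain pass theorem (Ambrosetti–Rabinowitz) without the Palais–Smale
condition: under the mountain pass geometry, the minimax level `c` satisfies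
`c ≥ τ` and there is a Palais–Smale sequence at level `c`. -/
theorem mountain_pass_palais_smale_sequence
    (E : Type*) [NormedAddCommGroup E] [NormedSpace ℝ E] [CompleteSpace E]
    (Φ : E → ℝ) (Φ' : E → (E →L[ℝ] ℝ))
    (hderiv : ∀ u : E, HasFDerivAt Φ (Φ' u) u)
    (hcont : Continuous Φ')
    (hΦ0 : Φ 0 = 0)
    (ρ τ : ℝ) (hρ : 0 < ρ) (hτ : 0 < τ)
    (e : E) (he : ρ < ‖e‖)
    (hgeom : ∀ u : E, ‖u‖ = ρ → τ ≤ Φ u)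
    (hΦe : Φ e ≤ 0)
    (c : ℝ)
    (hc : c = sInf {a : ℝ | ∃ γ : ℝ → E, ContinuousOn γ (Set.Icc 0 1) ∧
          γ 0 = 0 ∧ γ 1 = e ∧ a = sSup ((fun t => Φ (γ t)) '' Set.Icc 0 1)}) :
    τ ≤ c ∧ ∃ u : ℕ → E,
      Filter.Tendsto (fun k => Φ (u k)) Filter.atTop (nhds c) ∧
      Filter.Tendsto (fun k => ‖Φ' (u k)‖) Filter.atTop (nhds 0) := by
  have hΦ : Continuous Φ := continuous_iff_continuousAt.2 fun u => (hderiv u).continuousAt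
  rw [setOf_sSup_path_eq_range] at hc
  let X := {γ : C(unitInterval, E) // γ 0 = 0 ∧ γ 1 = e}
  let F : X → ℝ := fun γ => ⨆ t, Φ (γ.1 t)
  have hc : c = sInf (Set.range F) := hc
  have X_closed : IsClosed {γ : C(unitInterval, E) | γ 0 = 0 ∧ γ 1 = e} :=
    (isClosed_eq (continuous_eval_const 0) continuous_const).inter
      (isClosed_eq (continuous_eval_const 1) continuous_const)
  have : CompleteSpace X := X_closed.completeSpace_coe
  have : Nonempty X := ⟨⟨fun t => (t : ℝ) • e, by fun_prop⟩, by simp, by simp⟩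
  have τ_le : ∀ γ : X, τ ≤ F γ := by
    rintro ⟨γ, h0, h1⟩
    obtain ⟨t, ht⟩ : ρ ∈ Set.range fun t => ‖γ t‖ :=
      mem_range_of_exists_le_of_exists_ge (by fun_prop) ⟨0, by simpa [h0] using hρ.le⟩
        ⟨1, by simpa [h1] using he.le⟩
    exact (hgeom _ ht).trans (le_ciSup (ContinuousMap.bddAbove_range_comp hΦ γ) t)
  have F_bdd : BddBelow (Set.range F) := ⟨τ, Set.forall_mem_range.2 τ_le⟩
  have F_lsc : LowerSemicontinuous F :=
    (ContinuousMap.lowerSemicontinuous_iSup_comp hΦ).comp continuous_subtype_val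
  have approx : ∀ ε : ℝ, 0 < ε → ∃ u, c ≤ Φ u ∧ Φ u ≤ c + ε ∧ ‖Φ' u‖ ≤ ε := by
    intro ε hε
    obtain ⟨_, ⟨γ₀, rfl⟩, hγ₀⟩ := Real.lt_sInf_add_pos (Set.range_nonempty F) hε
    obtain ⟨γ, hγ, hmin⟩ := F_lsc.exists_ekeland F_bdd hε γ₀
    obtain ⟨t, ht, ht'⟩ := exists_norm_fderiv_le_of_almost_minimal hderiv hcont
      (B := {0, 1}) (Set.toFinite _).isClosed γ.1 hε
      (by
        have := τ_le γ
        rintro t (rfl | rfl)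
        · rw [γ.2.1, hΦ0]; exact hτ.trans_le this
        · rw [γ.2.2]; exact hΦe.trans_lt (hτ.trans_le this))
      (fun η hη => hmin ⟨η, (hη (by simp)).trans γ.2.1, (hη (by simp)).trans γ.2.2⟩)
    have ht : Φ (γ.1 t) = F γ := ht
    refine ⟨γ.1 t, ?_, ?_, ht'⟩
    · rw [ht, hc]; exact csInf_le F_bdd ⟨γ, rfl⟩
    · rw [ht, hc]; exact hγ.trans hγ₀.le
  refine ⟨hc ▸ le_csInf (Set.range_nonempty F) (Set.forall_mem_range.2 τ_le), ?_⟩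
  choose u hu_ge hu_le hu' using fun n : ℕ => approx (1 / ((n : ℝ) + 1)) Nat.one_div_pos_of_nat
  have h_lim : Filter.Tendsto (fun n : ℕ => 1 / ((n : ℝ) + 1)) Filter.atTop (nhds 0) :=
    tendsto_one_div_add_atTop_nhds_zero_nat
  exact ⟨u, tendsto_of_tendsto_of_tendsto_of_le_of_le tendsto_const_nhds
    (by simpa using h_lim.const_add c) hu_ge hu_le,
    squeeze_zero (fun _ => norm_nonneg _) hu' h_lim⟩
end

section
/- Let g : ℝ → ℝ be continuous and suppose that the map s ↦ g(s)/s³ is strictly increasing on (0,∞). Then the map s ↦ s·g(s) − 4·G(s) is strictly increasing on (0,∞), where G(s) = ∫₀^s g(t) dt. -/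
open intervalIntegral

/-- If `g(s)/s³` is strictly increasing on `(0,∞)`, then
`s·g(s) − 4·G(s)` is strictly increasing on `(0,∞)`. -/
theorem mul_sub_four_primitive_strictMonoOn
    (g : ℝ → ℝ) (hg : Continuous g)
    (hmono : StrictMonoOn (fun s => g s / s ^ 3) (Set.Ioi (0 : ℝ))) :
    StrictMonoOn (fun s => s * g s - 4 * ∫ t in (0:ℝ)..s, g t)
      (Set.Ioi (0 : ℝ)) := by
  intro a ha b hb hab
  rw [Set.mem_Ioi] at ha hb
  have hlt : g a / a ^ 3 < g b / b ^ 3 := hmono ha hb hab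
  set c := g b / b ^ 3 with hc
  have hgb : g b = c * b ^ 3 := by rw [hc]; field_simp
  have hga : g a < c * a ^ 3 := (div_lt_iff₀ (by positivity)).mp hlt
  have hadd : (∫ t in (0:ℝ)..a, g t) + ∫ t in a..b, g t = ∫ t in (0:ℝ)..b, g t :=
    integral_add_adjacent_intervals (hg.intervalIntegrable _ _) (hg.intervalIntegrable _ _)
  have hle : ∫ t in a..b, g t ≤ ∫ t in a..b, c * t ^ 3 := by
    refine integral_mono_on hab.le (hg.intervalIntegrable _ _)
      (Continuous.intervalIntegrable (by fun_prop) _ _) fun t ht => ?_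
    have ht0 : 0 < t := ha.trans_le ht.1
    exact (div_le_iff₀ (by positivity)).mp (hmono.monotoneOn ht0 hb ht.2)
  rw [integral_const_mul, integral_pow] at hle
  norm_num at hle
  have hmul : a * g a < a * (c * a ^ 3) := mul_lt_mul_of_pos_left hga ha
  simp only [← hadd, hgb]
  linarith
end

section
/- Let g : ℝ → ℝ be continuous with g(s) = 0 for s ≤ 0 and g(s) ≥ 0 for all s, and suppose that the map s ↦ g(s)/s³ is strictly increasing on (0,∞). Then s·g(s) − 4·G(s) ≥ 0 for all s ≥ 0, where G(s) = ∫₀^s g(t) dt. -/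
open intervalIntegral

/-- If `g` vanishes on `(-∞,0]`, is nonnegative, and `g(s)/s³` is strictly
increasing on `(0,∞)`, then `s·g(s) − 4·G(s) ≥ 0` for all `s ≥ 0`. -/
theorem mul_sub_four_primitive_nonneg
    (g : ℝ → ℝ) (hg : Continuous g)
    (hzero : ∀ s : ℝ, s ≤ 0 → g s = 0)
    (hnonneg : ∀ s : ℝ, 0 ≤ g s)
    (hmono : StrictMonoOn (fun s => g s / s ^ 3) (Set.Ioi (0 : ℝ))) :
    ∀ s : ℝ, 0 ≤ s → 0 ≤ s * g s - 4 * ∫ t in (0:ℝ)..s, g t := by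
  intro s hs
  rcases hs.eq_or_lt with rfl | hs
  · simp
  have hle : ∀ t ∈ Set.Icc (0 : ℝ) s, g t ≤ g s / s ^ 3 * t ^ 3 := by
    rintro t ⟨ht, hts⟩
    rcases ht.eq_or_lt with rfl | ht
    · simp [hzero 0 le_rfl]
    · have h : g t / t ^ 3 ≤ g s / s ^ 3 := hmono.monotoneOn ht hs hts
      rwa [div_le_iff₀ (by positivity)] at h
  have hint : ∫ t in (0 : ℝ)..s, g t ≤ ∫ t in (0 : ℝ)..s, g s / s ^ 3 * t ^ 3 :=
    integral_mono_on hs.le (hg.intervalIntegrable _ _)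
      (Continuous.intervalIntegrable (by fun_prop) _ _) hle
  have hval : ∫ t in (0 : ℝ)..s, g s / s ^ 3 * t ^ 3 = s * g s / 4 := by
    rw [integral_const_mul, integral_pow]
    norm_num
    field_simp
  linarith
end

section
/- Let m : ℝ → ℝ be continuous with m(t) ≥ 0 for t ≥ 0, and suppose that the map t ↦ m(t)/t is nonincreasing on (0,∞). Then the map t ↦ (1/2)·M(t) − (1/4)·m(t)·t is nondecreasing on [0,∞), where M(t) = ∫₀^t m(s) ds. -/
open intervalIntegral

/-- If `m ≥ 0` on `[0,∞)` and `m(t)/t` is nonincreasing on `(0,∞)`, then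
`(1/2)·M(t) − (1/4)·m(t)·t` is nondecreasing on `[0,∞)`. -/
theorem half_primitive_sub_quarter_monotoneOn
    (m : ℝ → ℝ) (hm : Continuous m)
    (hnonneg : ∀ t : ℝ, 0 ≤ t → 0 ≤ m t)
    (hanti : AntitoneOn (fun t => m t / t) (Set.Ioi (0 : ℝ))) :
    MonotoneOn (fun t => (1/2) * (∫ s in (0:ℝ)..t, m s) - (1/4) * m t * t)
      (Set.Ici (0 : ℝ)) := by
  intro a ha b hb hab
  have ha0 : 0 ≤ a := ha
  rcases hab.eq_or_lt with rfl | hlt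
  · exact le_rfl
  have hb0 : 0 < b := ha0.trans_lt hlt
  have hle : ∀ s : ℝ, 0 ≤ s → s ≤ b → m b / b * s ≤ m s := by
    intro s hs hsb
    rcases hs.eq_or_lt with rfl | hs0
    · simpa using hnonneg 0 le_rfl
    · exact (le_div_iff₀ hs0).mp (hanti hs0 hb0 hsb)
  have hint : ∫ s in a..b, m b / b * s ≤ ∫ s in a..b, m s :=
    integral_mono_on hab ((continuous_const.mul continuous_id).intervalIntegrable _ _)
      (hm.intervalIntegrable _ _) fun s hs => hle s (ha0.trans hs.1) hs.2
  rw [integral_const_mul, integral_id] at hint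
  have hadd := integral_add_adjacent_intervals (hm.intervalIntegrable 0 a)
    (hm.intervalIntegrable (μ := MeasureTheory.volume) a b)
  have hma : m b / b * a * a ≤ m a * a :=
    mul_le_mul_of_nonneg_right (hle a ha0 hab) ha0
  have hmb : m b / b * b * b = m b * b := by rw [div_mul_cancel₀ _ hb0.ne']
  dsimp only
  rw [← hadd]
  linarith
end

section
/- Let m : ℝ → ℝ be continuous with m(t) ≥ 0 for t ≥ 0, and suppose that the map t ↦ m(t)/t is nonincreasing on (0,∞). Then (1/2)·M(t) − (1/4)·m(t)·t ≥ 0 for all t ≥ 0, where M(t) = ∫₀^t m(s) ds. -/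
open intervalIntegral

/-- If `m ≥ 0` on `[0,∞)` and `m(t)/t` is nonincreasing on `(0,∞)`, then
`(1/2)·M(t) − (1/4)·m(t)·t ≥ 0` for all `t ≥ 0`. -/
theorem half_primitive_sub_quarter_nonneg
    (m : ℝ → ℝ) (hm : Continuous m)
    (hnonneg : ∀ t : ℝ, 0 ≤ t → 0 ≤ m t)
    (hanti : AntitoneOn (fun t => m t / t) (Set.Ioi (0 : ℝ))) :
    ∀ t : ℝ, 0 ≤ t → 0 ≤ (1/2) * (∫ s in (0:ℝ)..t, m s) - (1/4) * m t * t := by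
  intro t ht
  rcases ht.eq_or_lt with rfl | ht
  · simp
  have hle : ∀ s ∈ Set.Icc 0 t, m t / t * s ≤ m s := by
    rintro s ⟨hs, hst⟩
    rcases hs.eq_or_lt with rfl | hs
    · simpa using hnonneg 0 le_rfl
    · exact (le_div_iff₀ hs).mp (hanti hs ht hst)
  have hint : ∫ s in (0:ℝ)..t, m t / t * s ≤ ∫ s in (0:ℝ)..t, m s :=
    integral_mono_on ht.le ((by fun_prop : Continuous fun s => m t / t * s).intervalIntegrable 0 t)
      (hm.intervalIntegrable 0 t) hle
  have hval : ∫ s in (0:ℝ)..t, m t / t * s = m t * t / 2 := by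
    rw [integral_const_mul, integral_id]
    field_simp
    ring
  linarith
end

section
/- Let g : ℝ → ℝ be continuous, let s₀ > 0 and K₀ > 0, and suppose G(s) ≤ K₀·g(s) for all s ≥ s₀, where G(s) = ∫₀^s g(t) dt. Then G(s) ≥ G(s₀)·exp((s − s₀)/K₀) for all s ≥ s₀. -/
open intervalIntegral

/-- If `G(s) ≤ K₀·g(s)` for all `s ≥ s₀`, then
`G(s) ≥ G(s₀)·exp((s − s₀)/K₀)` for all `s ≥ s₀`. -/
theorem primitive_exponential_lower_bound
    (g : ℝ → ℝ) (hg : Continuous g)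
    (s₀ K₀ : ℝ) (hs₀ : 0 < s₀) (hK₀ : 0 < K₀)
    (hcond : ∀ s : ℝ, s₀ ≤ s → (∫ t in (0:ℝ)..s, g t) ≤ K₀ * g s) :
    ∀ s : ℝ, s₀ ≤ s →
      (∫ t in (0:ℝ)..s₀, g t) * Real.exp ((s - s₀) / K₀)
        ≤ ∫ t in (0:ℝ)..s, g t := by
  intro s hs
  have hderiv : ∀ x, HasDerivAt
      (fun x => (∫ t in (0:ℝ)..x, g t) * Real.exp (-((x - s₀) / K₀)))
      (g x * Real.exp (-((x - s₀) / K₀)) +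
        (∫ t in (0:ℝ)..x, g t) * (Real.exp (-((x - s₀) / K₀)) * -(1 / K₀))) x := fun x =>
    (hg.integral_hasStrictDerivAt 0 x).hasDerivAt.mul
      ((((hasDerivAt_id x).sub_const s₀).div_const K₀).neg.exp)
  have hmono : MonotoneOn
      (fun x => (∫ t in (0:ℝ)..x, g t) * Real.exp (-((x - s₀) / K₀))) (Set.Ici s₀) := by
    refine monotoneOn_of_deriv_nonneg (convex_Ici s₀)
      (fun x _ => (hderiv x).continuousAt.continuousWithinAt)
      (fun x _ => (hderiv x).differentiableAt.differentiableWithinAt) fun x hx => ?_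
    rw [(hderiv x).deriv]
    have hle : (∫ t in (0:ℝ)..x, g t) / K₀ ≤ g x :=
      (div_le_iff₀' hK₀).2 (hcond x (interior_subset hx))
    calc
      0 ≤ (g x - (∫ t in (0:ℝ)..x, g t) / K₀) * Real.exp (-((x - s₀) / K₀)) :=
        mul_nonneg (sub_nonneg.2 hle) (Real.exp_pos _).le
      _ = _ := by ring
  have h := hmono Set.self_mem_Ici hs hs
  simp only [sub_self, zero_div, neg_zero, Real.exp_zero, mul_one, Real.exp_neg] at h
  rwa [← div_eq_mul_inv, le_div_iff₀ (Real.exp_pos _)] at h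
end

section
/- Let g : ℝ → ℝ be continuous, let θ > 0 and R > 0, suppose G(R) > 0 and θ·G(s) ≤ s·g(s) for all s ≥ R, where G(s) = ∫₀^s g(t) dt. Then G(s) ≥ G(R)·(s/R)^θ for all s ≥ R. -/
open intervalIntegral

/-- If `θ·f(s) ≤ s·f'(s)` for all `s ≥ R > 0`, then `s ↦ f(s)·s^(-θ)` is monotone on `[R, ∞)`. -/
theorem monotoneOn_mul_rpow_neg {f f' : ℝ → ℝ} {θ R : ℝ} (hR : 0 < R)
    (hf : ∀ s, R ≤ s → HasDerivAt f (f' s) s)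
    (hcond : ∀ s, R ≤ s → θ * f s ≤ s * f' s) :
    MonotoneOn (fun s => f s * s ^ (-θ)) (Set.Ici R) := by
  have hderiv : ∀ s, R ≤ s → HasDerivAt (fun s => f s * s ^ (-θ))
      (f' s * s ^ (-θ) + f s * (-θ * s ^ (-θ - 1))) s := fun s hs =>
    (hf s hs).mul (Real.hasDerivAt_rpow_const (Or.inl (hR.trans_le hs).ne'))
  refine monotoneOn_of_deriv_nonneg (convex_Ici R)
    (fun s hs => (hderiv s hs).continuousAt.continuousWithinAt)
    (fun s hs => (hderiv s (interior_subset hs)).differentiableAt.differentiableWithinAt)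
    fun s hs => ?_
  have hRs : R ≤ s := interior_subset hs
  have hs0 : 0 < s := hR.trans_le hRs
  have hpow : s ^ (-θ) = s ^ (-θ - 1) * s := by
    rw [← Real.rpow_add_one hs0.ne', sub_add_cancel]
  rw [(hderiv s hRs).deriv, hpow]
  calc 0 ≤ s ^ (-θ - 1) * (s * f' s - θ * f s) :=
        mul_nonneg (Real.rpow_nonneg hs0.le _) (sub_nonneg.2 (hcond s hRs))
    _ = _ := by ring

/-- If `G(R) > 0` and `θ·G(s) ≤ s·g(s)` for all `s ≥ R`, then
`G(s) ≥ G(R)·(s/R)^θ` for all `s ≥ R`. -/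
theorem primitive_power_lower_bound
    (g : ℝ → ℝ) (hg : Continuous g)
    (θ R : ℝ) (hθ : 0 < θ) (hR : 0 < R)
    (hGR : 0 < ∫ t in (0:ℝ)..R, g t)
    (hcond : ∀ s : ℝ, R ≤ s → θ * (∫ t in (0:ℝ)..s, g t) ≤ s * g s) :
    ∀ s : ℝ, R ≤ s →
      (∫ t in (0:ℝ)..R, g t) * (s / R) ^ θ ≤ ∫ t in (0:ℝ)..s, g t := by
  intro s hs
  have hs0 : 0 < s := hR.trans_le hs
  have hmono := monotoneOn_mul_rpow_neg hR
    (fun x _ => integral_hasDerivAt_right (hg.intervalIntegrable 0 x)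
      (hg.stronglyMeasurableAtFilter _ _) hg.continuousAt) hcond
  have h := hmono Set.self_mem_Ici hs hs
  simp only [Real.rpow_neg hR.le, Real.rpow_neg hs0.le, ← div_eq_mul_inv] at h
  rw [le_div_iff₀ (Real.rpow_pos_of_pos hs0 θ)] at h
  rwa [Real.div_rpow hs0.le hR.le, mul_div_assoc', mul_div_right_comm]
end

section
/- Let x₀ ∈ ℝ² and d > 0, and for each integer n ≥ 2 let G_n(x) = G̃_n((x − x₀)/d). Then liminf_{n→∞} ∫_{B_d(x₀)} exp(4π·G_n(x)²) dx ≥ 3π·d², where the integral is with respect to Lebesgue measure on ℝ². -/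
open MeasureTheory Real

/-- The truncated and scaled Moser function `G̃ₙ` on `ℝ²`. -/
noncomputable def moserFn (n : ℕ) (x : EuclideanSpace ℝ (Fin 2)) : ℝ :=
  if ‖x‖ ≤ 1 / n then Real.sqrt (Real.log n) / Real.sqrt (2 * Real.pi)
  else if ‖x‖ ≤ 1 then
    Real.log (1 / ‖x‖) / (Real.sqrt (2 * Real.pi) * Real.sqrt (Real.log n))
  else 0

/-- The exponential `exp (4π G̃ₙ²)` as a function of the radius `r = |x|`. -/
noncomputable def moserExp (n : ℕ) (r : ℝ) : ℝ :=
  Real.exp (4 * Real.pi * (if r ≤ 1 / n then Real.sqrt (Real.log n) / Real.sqrt (2 * Real.pi)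
    else if r ≤ 1 then
      Real.log (1 / r) / (Real.sqrt (2 * Real.pi) * Real.sqrt (Real.log n))
    else 0) ^ 2)

lemma moserExp_norm (n : ℕ) (x : EuclideanSpace ℝ (Fin 2)) :
    moserExp n ‖x‖ = Real.exp (4 * Real.pi * moserFn n x ^ 2) := rfl

lemma measurable_moserExp (n : ℕ) : Measurable (moserExp n) := by
  unfold moserExp
  refine Real.measurable_exp.comp (Measurable.const_mul (Measurable.pow_const ?_ 2) _)
  refine Measurable.ite measurableSet_Iic measurable_const
    (Measurable.ite measurableSet_Iic ?_ measurable_const)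
  fun_prop

lemma log_natCast_pos {n : ℕ} (hn : 2 ≤ n) : 0 < Real.log n :=
  Real.log_pos (by exact_mod_cast hn)

lemma moserExp_of_le {n : ℕ} (hn : 2 ≤ n) {r : ℝ} (hr : r ≤ 1 / n) :
    moserExp n r = (n : ℝ) ^ 2 := by
  have hL := log_natCast_pos hn
  have hn0 : (0 : ℝ) < n := by positivity
  rw [moserExp, if_pos hr, div_pow, Real.sq_sqrt hL.le, Real.sq_sqrt (by positivity)]
  have h : 4 * Real.pi * (Real.log n / (2 * Real.pi)) = Real.log n + Real.log n := by
    field_simp; ring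
  rw [h, Real.exp_add, Real.exp_log hn0, sq]

lemma moserExp_of_lt {n : ℕ} (hn : 2 ≤ n) {r : ℝ} (hr : 1 / n < r) (hr1 : r ≤ 1) :
    moserExp n r = Real.exp (2 * Real.log r ^ 2 / Real.log n) := by
  have hL := log_natCast_pos hn
  rw [moserExp, if_neg hr.not_ge, if_pos hr1, div_pow, mul_pow, Real.sq_sqrt hL.le,
    Real.sq_sqrt (by positivity), one_div, Real.log_inv]
  congr 1
  field_simp
  ring

lemma one_le_moserExp (n : ℕ) (r : ℝ) : 1 ≤ moserExp n r :=
  Real.one_le_exp (by positivity)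

lemma exp_int_mul_log_add {n : ℕ} (hn : 2 ≤ n) {r : ℝ} (hr : 0 < r) (a b : ℤ) :
    Real.exp (a * Real.log r + b * Real.log n) = r ^ a * (n : ℝ) ^ b := by
  have hn0 : (0 : ℝ) < n := by positivity
  rw [Real.exp_add, ← Real.log_zpow, ← Real.log_zpow, Real.exp_log (by positivity),
    Real.exp_log (by positivity)]

lemma zpow_mul_le_moserExp {n : ℕ} (hn : 2 ≤ n) {r : ℝ} (hr : 1 / n ≤ r) (hr1 : r ≤ 1) :
    r ^ (-4 : ℤ) * (n : ℝ) ^ (-2 : ℤ) ≤ moserExp n r := by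
  have hL := log_natCast_pos hn
  have hn0 : (0 : ℝ) < n := by positivity
  rcases hr.eq_or_lt with rfl | hr
  · rw [moserExp_of_le hn le_rfl]
    apply le_of_eq
    simp only [one_div, zpow_neg, inv_zpow, inv_inv]
    norm_cast
    push_cast
    field_simp
  · have hr0 : 0 < r := lt_trans (by positivity) hr
    rw [moserExp_of_lt hn hr hr1, ← exp_int_mul_log_add hn hr0, Real.exp_le_exp, le_div_iff₀ hL]
    push_cast
    nlinarith [sq_nonneg (Real.log r + Real.log n)]

lemma moserExp_le {n : ℕ} (hn : 2 ≤ n) {r : ℝ} (hr : 1 / n ≤ r) (hr1 : r ≤ 1) :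
    moserExp n r ≤ r⁻¹ + r ^ (-3 : ℤ) * (n : ℝ)⁻¹ := by
  have hL := log_natCast_pos hn
  have hn0 : (0 : ℝ) < n := by positivity
  rcases hr.eq_or_lt with rfl | hr
  · rw [moserExp_of_le hn le_rfl]
    have h : (1 / (n : ℝ)) ^ (-3 : ℤ) * (n : ℝ)⁻¹ = (n : ℝ) ^ 2 := by
      simp only [one_div, zpow_neg, inv_zpow, inv_inv]
      norm_cast
      push_cast
      field_simp
    rw [h]
    have : 0 ≤ (1 / (n : ℝ))⁻¹ := by positivity
    linarith
  · have hr0 : 0 < r := lt_trans (by positivity) hr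
    have hl : Real.log r ≤ 0 := Real.log_nonpos hr0.le hr1
    have hl' : -Real.log n ≤ Real.log r := by
      rw [← Real.log_inv, ← one_div]
      exact Real.log_le_log (by positivity) hr.le
    have e1 := exp_int_mul_log_add hn hr0 (-1) 0
    have e2 := exp_int_mul_log_add hn hr0 (-3) (-1)
    simp only [zpow_neg_one, zpow_zero, mul_one] at e1
    rw [zpow_neg_one] at e2
    rw [moserExp_of_lt hn hr hr1, ← e1, ← e2]
    rcases le_total (-(2 * Real.log r)) (Real.log n) with h | h
    · refine le_add_of_le_of_nonneg (Real.exp_le_exp.2 ?_) (Real.exp_pos _).le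
      rw [div_le_iff₀ hL]
      push_cast
      nlinarith
    · refine le_add_of_nonneg_of_le (Real.exp_pos _).le (Real.exp_le_exp.2 ?_)
      rw [div_le_iff₀ hL]
      push_cast
      nlinarith

lemma moserExp_le_sq {n : ℕ} (hn : 2 ≤ n) {r : ℝ} (hr1 : r ≤ 1) :
    moserExp n r ≤ (n : ℝ) ^ 2 := by
  have hL := log_natCast_pos hn
  have hn0 : (0 : ℝ) < n := by positivity
  rcases le_or_gt r (1 / n) with hr | hr
  · exact (moserExp_of_le hn hr).le
  · have hr0 : 0 < r := lt_trans (by positivity) hr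
    have hl : Real.log r ≤ 0 := Real.log_nonpos hr0.le hr1
    have hl' : -Real.log n ≤ Real.log r := by
      rw [← Real.log_inv, ← one_div]
      exact Real.log_le_log (by positivity) hr.le
    have e := exp_int_mul_log_add hn hr0 0 2
    simp only [zpow_zero, one_mul] at e
    have e' : (n : ℝ) ^ 2 = (n : ℝ) ^ (2 : ℤ) := by norm_cast
    rw [moserExp_of_lt hn hr hr1, e', ← e, Real.exp_le_exp, div_le_iff₀ hL]
    push_cast
    nlinarith

lemma intervalIntegrable_mul_moserExp {n : ℕ} (hn : 2 ≤ n) {a b : ℝ} (ha : 0 ≤ a) (hab : a ≤ b)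
    (hb : b ≤ 1) : IntervalIntegrable (fun r => r * moserExp n r) volume a b := by
  rw [intervalIntegrable_iff_integrableOn_Ioc_of_le hab]
  refine Measure.integrableOn_of_bounded (M := (n : ℝ) ^ 2) (by simp)
    (measurable_id.mul (measurable_moserExp n)).aestronglyMeasurable ?_
  filter_upwards [ae_restrict_mem measurableSet_Ioc] with r hr
  have hr0 : 0 ≤ r := ha.trans hr.1.le
  have hr1 : r ≤ 1 := hr.2.trans hb
  have h1 := one_le_moserExp n r
  rw [Real.norm_of_nonneg (by positivity)]
  nlinarith [moserExp_le_sq hn hr1]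

lemma integral_mul_moserExp_core {n : ℕ} (hn : 2 ≤ n) :
    ∫ r in (0 : ℝ)..1 / n, r * moserExp n r = 1 / 2 := by
  have hn0 : (0 : ℝ) < n := by positivity
  have : ∫ r in (0 : ℝ)..1 / n, r * moserExp n r = ∫ r in (0 : ℝ)..1 / n, r * (n : ℝ) ^ 2 := by
    refine intervalIntegral.integral_congr fun r hr => ?_
    rw [Set.uIcc_of_le (by positivity)] at hr
    simp only [moserExp_of_le hn hr.2]
  rw [this, intervalIntegral.integral_mul_const, integral_id]
  field_simp
  ring

lemma le_integral_mul_moserExp {n : ℕ} (hn : 2 ≤ n) :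
    3 / 2 - 1 / (n : ℝ) ≤ ∫ r in (0 : ℝ)..1, r * moserExp n r := by
  have hn0 : (0 : ℝ) < n := by positivity
  have hn1 : (1 : ℝ) ≤ n := by exact_mod_cast (by omega : 1 ≤ n)
  obtain ⟨s, hs1, hs⟩ : ∃ s : ℝ, 1 ≤ s ∧ s ^ 2 = n :=
    ⟨√n, Real.one_le_sqrt.2 hn1, Real.sq_sqrt hn0.le⟩
  have hs0 : 0 < s := by linarith
  have h1 : 1 / (n : ℝ) ≤ 1 / s := one_div_le_one_div_of_le hs0 (by nlinarith)
  have h2 : 1 / s ≤ 1 := (div_le_one hs0).2 hs1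
  have h0 : 0 ≤ 1 / (n : ℝ) := by positivity
  have i1 := intervalIntegrable_mul_moserExp hn le_rfl h0 (h1.trans h2)
  have i2 := intervalIntegrable_mul_moserExp hn h0 h1 h2
  have i3 := intervalIntegrable_mul_moserExp hn (by positivity) h2 le_rfl
  rw [← intervalIntegral.integral_add_adjacent_intervals i1 (i2.trans i3),
    ← intervalIntegral.integral_add_adjacent_intervals i2 i3, integral_mul_moserExp_core hn]
  have hz : (0 : ℝ) ∉ Set.uIcc (1 / (n : ℝ)) (1 / s) := by
    rw [Set.uIcc_of_le h1]
    exact fun h => absurd h.1 (not_le.2 (by positivity))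
  have b2 : (1 - 1 / (n : ℝ)) / 2 ≤ ∫ r in 1 / (n : ℝ)..1 / s, r * moserExp n r := by
    have e : ∫ r in 1 / (n : ℝ)..1 / s, r ^ (-3 : ℤ) * (n : ℝ) ^ (-2 : ℤ)
        = (1 - 1 / (n : ℝ)) / 2 := by
      rw [intervalIntegral.integral_mul_const, integral_zpow (Or.inr ⟨by norm_num, hz⟩)]
      norm_num
      rw [← hs]
      field_simp
      ring
    rw [← e]
    refine intervalIntegral.integral_mono_on h1
      ((intervalIntegral.intervalIntegrable_zpow (Or.inr hz)).mul_const _) i2 fun r hr => ?_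
    have hr0 : 0 < r := lt_of_lt_of_le (by positivity) hr.1
    have e : r ^ (-3 : ℤ) = r * r ^ (-4 : ℤ) := by
      rw [← zpow_one_add₀ hr0.ne']; norm_num
    rw [e, mul_assoc]
    exact mul_le_mul_of_nonneg_left (zpow_mul_le_moserExp hn hr.1 (hr.2.trans h2)) hr0.le
  have b3 : (1 - 1 / (n : ℝ)) / 2 ≤ ∫ r in 1 / s..1, r * moserExp n r := by
    have e : ∫ r in 1 / s..1, r = (1 - 1 / (n : ℝ)) / 2 := by
      rw [integral_id, ← hs]
      field_simp
    rw [← e]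
    refine intervalIntegral.integral_mono_on h2 intervalIntegral.intervalIntegrable_id i3
      fun r hr => ?_
    have hr0 : 0 < r := lt_of_lt_of_le (by positivity) hr.1
    exact le_mul_of_one_le_right hr0.le (one_le_moserExp n r)
  linarith

lemma integral_mul_moserExp_le {n : ℕ} (hn : 2 ≤ n) :
    ∫ r in (0 : ℝ)..1, r * moserExp n r ≤ 5 / 2 := by
  have hn0 : (0 : ℝ) < n := by positivity
  have hn1 : (1 : ℝ) ≤ n := by exact_mod_cast (by omega : 1 ≤ n)
  have h1 : 1 / (n : ℝ) ≤ 1 := (div_le_one hn0).2 hn1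
  have h0 : 0 ≤ 1 / (n : ℝ) := by positivity
  have i1 := intervalIntegrable_mul_moserExp hn le_rfl h0 h1
  have i2 := intervalIntegrable_mul_moserExp hn h0 h1 le_rfl
  rw [← intervalIntegral.integral_add_adjacent_intervals i1 i2, integral_mul_moserExp_core hn]
  have hz : (0 : ℝ) ∉ Set.uIcc (1 / (n : ℝ)) 1 := by
    rw [Set.uIcc_of_le h1]
    exact fun h => absurd h.1 (not_le.2 (by positivity))
  have hi : IntervalIntegrable (fun r : ℝ => r ^ (-2 : ℤ) * (n : ℝ)⁻¹) volume (1 / (n : ℝ)) 1 :=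
    (intervalIntegral.intervalIntegrable_zpow (Or.inr hz)).mul_const _
  have e : ∫ r in 1 / (n : ℝ)..1, (1 + r ^ (-2 : ℤ) * (n : ℝ)⁻¹) = 2 * (1 - 1 / n) := by
    rw [intervalIntegral.integral_add intervalIntegrable_const hi,
      intervalIntegral.integral_mul_const, integral_zpow (Or.inr ⟨by norm_num, hz⟩),
      intervalIntegral.integral_const]
    norm_num
    field_simp
    ring
  have b : ∫ r in 1 / (n : ℝ)..1, r * moserExp n r ≤ 2 * (1 - 1 / n) := by
    rw [← e]
    refine intervalIntegral.integral_mono_on h1 i2 (intervalIntegrable_const.add hi)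
      fun r hr => ?_
    have hr0 : 0 < r := lt_of_lt_of_le (by positivity) hr.1
    have e : 1 + r ^ (-2 : ℤ) * (n : ℝ)⁻¹ = r * (r⁻¹ + r ^ (-3 : ℤ) * (n : ℝ)⁻¹) := by
      have : r ^ (-2 : ℤ) = r * r ^ (-3 : ℤ) := by
        rw [← zpow_one_add₀ hr0.ne']; norm_num
      rw [this, mul_add, mul_inv_cancel₀ hr0.ne', mul_assoc]
    rw [e]
    exact mul_le_mul_of_nonneg_left (moserExp_le hn hr.1 hr.2) hr0.le
  linarith

lemma setIntegral_ball_fun_norm (g : ℝ → ℝ) (x₀ : EuclideanSpace ℝ (Fin 2)) {d : ℝ} (hd : 0 < d) :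
    ∫ x in Metric.ball x₀ d, g ‖d⁻¹ • (x - x₀)‖ =
      2 * Real.pi * d ^ 2 * ∫ r in (0 : ℝ)..1, r * g r := by
  have h : ∀ x, (Metric.ball x₀ d).indicator (fun x => g ‖d⁻¹ • (x - x₀)‖) x =
      (fun y : EuclideanSpace ℝ (Fin 2) => (Set.Iio (1 : ℝ)).indicator g ‖d⁻¹ • y‖) (x - x₀) := by
    intro x
    have hiff : x ∈ Metric.ball x₀ d ↔ ‖d⁻¹ • (x - x₀)‖ ∈ Set.Iio (1 : ℝ) := by
      rw [mem_ball_iff_norm, norm_smul, Real.norm_of_nonneg (by positivity), Set.mem_Iio,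
        inv_mul_lt_one₀ hd]
    by_cases hx : x ∈ Metric.ball x₀ d
    · simp only [Set.indicator_of_mem hx, Set.indicator_of_mem (hiff.1 hx)]
    · simp only [Set.indicator_of_notMem hx, Set.indicator_of_notMem (mt hiff.2 hx)]
  rw [← integral_indicator measurableSet_ball, integral_congr_ae (.of_forall h),
    integral_sub_right_eq_self
      (fun y : EuclideanSpace ℝ (Fin 2) => (Set.Iio (1 : ℝ)).indicator g ‖d⁻¹ • y‖) x₀,
    Measure.integral_comp_smul volume
      (fun y : EuclideanSpace ℝ (Fin 2) => (Set.Iio (1 : ℝ)).indicator g ‖y‖),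
    integral_fun_norm_addHaar, intervalIntegral.integral_of_le zero_le_one,
    integral_Ioc_eq_integral_Ioo]
  have hr : ∀ r : ℝ, r ^ (Module.finrank ℝ (EuclideanSpace ℝ (Fin 2)) - 1) •
      (Set.Iio (1 : ℝ)).indicator g r = (Set.Iio (1 : ℝ)).indicator (fun r => r * g r) r := by
    intro r
    simp [Set.indicator_apply]
  simp_rw [hr]
  rw [setIntegral_indicator measurableSet_Iio, Set.Ioi_inter_Iio, Measure.real,
    EuclideanSpace.volume_ball_fin_two]
  simp [Real.pi_pos.le]
  ring

/-- The Moser functions `Gₙ(x) = G̃ₙ((x − x₀)/d)` satisfy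
`liminf ∫_{B_d(x₀)} exp(4π Gₙ²) ≥ 3π d²`. -/
theorem liminf_integral_exp_moser
    (x₀ : EuclideanSpace ℝ (Fin 2)) (d : ℝ) (hd : 0 < d) :
    3 * Real.pi * d ^ 2 ≤
      Filter.atTop.liminf (fun n : ℕ =>
        ∫ x in Metric.ball x₀ d,
          Real.exp (4 * Real.pi * (moserFn n (d⁻¹ • (x - x₀))) ^ 2)) := by
  have key : ∀ n : ℕ, ∫ x in Metric.ball x₀ d,
      Real.exp (4 * Real.pi * (moserFn n (d⁻¹ • (x - x₀))) ^ 2) =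
      2 * Real.pi * d ^ 2 * ∫ r in (0 : ℝ)..1, r * moserExp n r := fun n =>
    setIntegral_ball_fun_norm (moserExp n) x₀ hd
  simp_rw [key]
  have hlim : Filter.Tendsto (fun n : ℕ => 2 * Real.pi * d ^ 2 * (3 / 2 - 1 / (n : ℝ)))
      Filter.atTop (nhds (3 * Real.pi * d ^ 2)) := by
    have := (tendsto_one_div_atTop_nhds_zero_nat (𝕜 := ℝ)).const_sub (3 / 2) |>.const_mul
      (2 * Real.pi * d ^ 2)
    convert this using 2
    ring
  rw [← hlim.liminf_eq]
  refine Filter.liminf_le_liminf ?_ hlim.isBoundedUnder_ge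
    (Filter.IsBoundedUnder.isCoboundedUnder_ge
      (Filter.isBoundedUnder_of_eventually_le (a := 2 * Real.pi * d ^ 2 * (5 / 2)) ?_))
  · filter_upwards [Filter.eventually_ge_atTop 2] with n hn
    exact mul_le_mul_of_nonneg_left (le_integral_mul_moserExp hn) (by positivity)
  · filter_upwards [Filter.eventually_ge_atTop 2] with n hn
    exact mul_le_mul_of_nonneg_left (integral_mul_moserExp_le hn) (by positivity)
end

section
/- Let x₀ ∈ ℝ² and d > 0, and for each integer n ≥ 2 let G_n(x) = G̃_n((x − x₀)/d). Then ∫_{B_d(x₀)} exp(4π·G_n(x)²) dx = π·d² + 2π·d²·(log n)·∫₀¹ n^{2s² − 2s} ds, where the left-hand integral is with respect to Lebesgue measure on ℝ². -/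
open MeasureTheory Real

/-- Polar coordinates for radial functions on the unit disc of `ℝ²`. -/
lemma setIntegral_unitBall_fun_norm_fin_two (f : ℝ → ℝ) :
    ∫ x in Metric.ball (0 : EuclideanSpace ℝ (Fin 2)) 1, f ‖x‖ =
      2 * π * ∫ r in (0:ℝ)..1, r * f r := by
  have hball : volume.real (Metric.ball (0 : EuclideanSpace ℝ (Fin 2)) 1) = π := by
    simp [measureReal_def, EuclideanSpace.volume_ball_fin_two, pi_pos.le]
  have hind : (Metric.ball (0 : EuclideanSpace ℝ (Fin 2)) 1).indicator (fun x => f ‖x‖) =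
      fun x => (Set.Iio 1).indicator f ‖x‖ := by
    ext x
    simp [Set.indicator]
  have hmul : (fun r : ℝ => r * (Set.Iio 1).indicator f r) =
      (Set.Iio 1).indicator (fun r => r * f r) := by
    ext r
    by_cases hr : r < 1 <;> simp [Set.indicator, hr]
  rw [← integral_indicator Metric.isOpen_ball.measurableSet, hind, integral_fun_norm_addHaar,
    hball, intervalIntegral.integral_of_le zero_le_one, integral_Ioc_eq_integral_Ioo]
  simp only [finrank_euclideanSpace, Fintype.card_fin, Nat.add_one_sub_one, pow_one,
    smul_eq_mul, nsmul_eq_mul, Nat.cast_ofNat]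
  rw [hmul, setIntegral_indicator measurableSet_Iio, Set.Ioi_inter_Iio, mul_assoc]

/-- Rescaling a ball of `ℝ²` to the unit ball. -/
lemma setIntegral_ball_comp_inv_smul_sub_fin_two (g : EuclideanSpace ℝ (Fin 2) → ℝ)
    (x₀ : EuclideanSpace ℝ (Fin 2)) {d : ℝ} (hd : 0 < d) :
    ∫ x in Metric.ball x₀ d, g (d⁻¹ • (x - x₀)) = d ^ 2 * ∫ x in Metric.ball 0 1, g x := by
  have hind : (Metric.ball x₀ d).indicator (fun x => g (d⁻¹ • (x - x₀))) =
      fun x => (Metric.ball 0 1).indicator g (d⁻¹ • (x - x₀)) := by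
    ext x
    have hmem : d⁻¹ • (x - x₀) ∈ Metric.ball (0 : EuclideanSpace ℝ (Fin 2)) 1 ↔
        x ∈ Metric.ball x₀ d := by
      rw [mem_ball_zero_iff, mem_ball_iff_norm, norm_smul, norm_inv, norm_of_nonneg hd.le,
        inv_mul_lt_one₀ hd]
    by_cases hx : x ∈ Metric.ball x₀ d
    · rw [Set.indicator_of_mem hx, Set.indicator_of_mem (hmem.2 hx)]
    · rw [Set.indicator_of_notMem hx, Set.indicator_of_notMem (mt hmem.1 hx)]
  rw [← integral_indicator Metric.isOpen_ball.measurableSet, hind,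
    integral_sub_right_eq_self (fun x => (Metric.ball 0 1).indicator g (d⁻¹ • x)) x₀,
    Measure.integral_comp_inv_smul_of_nonneg volume _ hd.le,
    integral_indicator Metric.isOpen_ball.measurableSet]
  simp

/-- The substitution `r = exp (-L * s)` in the annulus part of the Moser integral. -/
lemma integral_mul_exp_log_sq_div {L : ℝ} (hL : 0 < L) :
    ∫ r in exp (-L)..1, r * exp (2 * log r ^ 2 / L) =
      L * ∫ s in (0:ℝ)..1, exp ((2 * s ^ 2 - 2 * s) * L) := by
  have hcont : ContinuousOn (fun r => r * exp (2 * log r ^ 2 / L))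
      ((fun s => exp (-L * s)) '' Set.uIcc 0 1) := by
    rintro _ ⟨s, -, rfl⟩
    have := (exp_pos (-L * s)).ne'
    exact ContinuousAt.continuousWithinAt (by fun_prop (disch := assumption))
  have hsubst := intervalIntegral.integral_comp_mul_deriv' (a := 0) (b := 1)
    (f := fun s => exp (-L * s)) (f' := fun s => exp (-L * s) * -L)
    (fun s _ => by simpa using ((hasDerivAt_id s).const_mul (-L)).exp)
    (by fun_prop) hcont
  simp only [mul_zero, exp_zero, mul_one] at hsubst
  rw [intervalIntegral.integral_symm, ← hsubst, ← intervalIntegral.integral_neg,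
    ← intervalIntegral.integral_const_mul]
  refine intervalIntegral.integral_congr fun s _ => ?_
  have hexp : exp ((2 * s ^ 2 - 2 * s) * L) =
      exp (-L * s) * exp (2 * (-L * s) ^ 2 / L) * exp (-L * s) := by
    rw [← exp_add, ← exp_add]
    congr 1
    field_simp
    ring
  simp only [Function.comp_apply, log_exp, hexp]
  ring

/-- The radial profile of `moserFn`. -/
noncomputable def moserProfile (n : ℕ) (r : ℝ) : ℝ :=
  if r ≤ 1 / n then √(log n) / √(2 * π)
  else if r ≤ 1 then log (1 / r) / (√(2 * π) * √(log n))
  else 0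

lemma exp_moserProfile_of_le (n : ℕ) {r : ℝ} (hr : r ≤ 1 / n) :
    exp (4 * π * moserProfile n r ^ 2) = exp (2 * log n) := by
  have hlog : 0 ≤ log n := log_natCast_nonneg n
  have hpi := pi_pos
  rw [moserProfile, if_pos hr, div_pow, sq_sqrt hlog, sq_sqrt (by positivity)]
  congr 1
  field_simp
  ring

lemma exp_moserProfile_of_ge {n : ℕ} (hn : 2 ≤ n) {r : ℝ} (hr : 1 / n ≤ r) (hr1 : r ≤ 1) :
    exp (4 * π * moserProfile n r ^ 2) = exp (2 * log r ^ 2 / log n) := by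
  have hlog : 0 < log n := log_pos (by exact_mod_cast hn)
  have hpi := pi_pos
  rcases hr.eq_or_lt with rfl | hr
  · rw [exp_moserProfile_of_le n le_rfl, one_div, log_inv]
    congr 1
    field_simp
  · rw [moserProfile, if_neg hr.not_ge, if_pos hr1, div_pow, mul_pow, sq_sqrt hlog.le,
      sq_sqrt (by positivity), one_div, log_inv]
    congr 1
    field_simp
    ring

lemma integral_mul_exp_moserProfile {n : ℕ} (hn : 2 ≤ n) :
    ∫ r in (0:ℝ)..1, r * exp (4 * π * moserProfile n r ^ 2) =
      1 / 2 + log n * ∫ s in (0:ℝ)..1, exp ((2 * s ^ 2 - 2 * s) * log n) := by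
  have hn0 : (0:ℝ) < n := by positivity
  have hlog : 0 < log n := log_pos (by exact_mod_cast hn)
  have hle0 : (0:ℝ) ≤ 1 / n := by positivity
  have hle1 : 1 / (n:ℝ) ≤ 1 := by
    rw [div_le_one hn0]
    exact_mod_cast (by lia : 1 ≤ n)
  have hinner : Set.EqOn (fun r => r * exp (4 * π * moserProfile n r ^ 2))
      (fun r => r * exp (2 * log n)) (Set.uIcc 0 (1 / n)) := by
    intro r hr
    rw [Set.uIcc_of_le hle0] at hr
    simp only [exp_moserProfile_of_le n hr.2]
  have houter : Set.EqOn (fun r => r * exp (4 * π * moserProfile n r ^ 2))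
      (fun r => r * exp (2 * log r ^ 2 / log n)) (Set.uIcc (1 / n) 1) := by
    intro r hr
    rw [Set.uIcc_of_le hle1] at hr
    simp only [exp_moserProfile_of_ge hn hr.1 hr.2]
  have hcont : ContinuousOn (fun r => r * exp (2 * log r ^ 2 / log n))
      (Set.uIcc (1 / (n:ℝ)) 1) := by
    intro r hr
    rw [Set.uIcc_of_le hle1] at hr
    have : r ≠ 0 := ((by positivity : (0:ℝ) < 1 / n).trans_le hr.1).ne'
    exact ContinuousAt.continuousWithinAt (by fun_prop (disch := assumption))
  have hexp : 1 / (n:ℝ) = exp (-log n) := by rw [exp_neg, exp_log hn0, one_div]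
  rw [← intervalIntegral.integral_add_adjacent_intervals
      ((ContinuousOn.congr (by fun_prop) hinner).intervalIntegrable)
      ((hcont.congr houter).intervalIntegrable),
    intervalIntegral.integral_congr hinner, intervalIntegral.integral_congr houter]
  congr 1
  · rw [intervalIntegral.integral_mul_const, integral_id, two_mul, exp_add, exp_log hn0]
    field_simp
    ring
  · rw [hexp, integral_mul_exp_log_sq_div hlog]

/-- For the Moser functions `Gₙ(x) = G̃ₙ((x − x₀)/d)`, one has
`∫_{B_d(x₀)} exp(4π Gₙ²) dx = π d² + 2π d² (log n) ∫₀¹ n^{2s²−2s} ds`. -/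
theorem integral_exp_moser_eq
    (x₀ : EuclideanSpace ℝ (Fin 2)) (d : ℝ) (hd : 0 < d)
    (n : ℕ) (hn : 2 ≤ n) :
    (∫ x in Metric.ball x₀ d,
        Real.exp (4 * Real.pi * (moserFn n (d⁻¹ • (x - x₀))) ^ 2))
      = Real.pi * d ^ 2 + 2 * Real.pi * d ^ 2 * Real.log n *
          ∫ s in (0:ℝ)..1, Real.exp ((2 * s ^ 2 - 2 * s) * Real.log n) := by
  have hradial : ∀ x, exp (4 * π * moserFn n x ^ 2) =
      exp (4 * π * moserProfile n ‖x‖ ^ 2) := fun x => rfl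
  rw [setIntegral_ball_comp_inv_smul_sub_fin_two (fun x => exp (4 * π * moserFn n x ^ 2)) x₀ hd]
  simp only [hradial]
  rw [setIntegral_unitBall_fun_norm_fin_two (fun r => exp (4 * π * moserProfile n r ^ 2)),
    integral_mul_exp_moserProfile hn]
  ring
end

section
/- For every real number n > 1 one has (log n)·∫₀¹ n^{2s² − 2s} ds ≥ 1 − 1/n. -/
open intervalIntegral in
/-- An antiderivative `g` of a continuous function dominated by `f` bounds `∫ f` from below. -/
theorem sub_le_integral_of_hasDerivAt_le {f g g' : ℝ → ℝ} {a b : ℝ} (hab : a ≤ b)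
    (hf : Continuous f) (hg' : Continuous g') (hg : ∀ x, HasDerivAt g (g' x) x)
    (h : ∀ x ∈ Set.Icc a b, g' x ≤ f x) :
    g b - g a ≤ ∫ x in a..b, f x := by
  rw [← integral_eq_sub_of_hasDerivAt (fun x _ => hg x) (hg'.intervalIntegrable a b)]
  exact integral_mono_on hab (hg'.intervalIntegrable a b) (hf.intervalIntegrable a b) h

/-- For every real `n > 1`, `(log n)·∫₀¹ n^{2s²−2s} ds ≥ 1 − 1/n`. -/
theorem log_mul_integral_ge
    (n : ℝ) (hn : 1 < n) :
    1 - 1 / n ≤ Real.log n *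
      ∫ s in (0:ℝ)..1, Real.exp ((2 * s ^ 2 - 2 * s) * Real.log n) := by
  have hexp : 1 / n = Real.exp (-Real.log n) := by
    rw [Real.exp_neg, Real.exp_log (by linarith), one_div]
  have hL : 0 < Real.log n := Real.log_pos hn
  rw [hexp]
  generalize Real.log n = L at hL ⊢
  rw [← intervalIntegral.integral_const_mul]
  have hf : Continuous fun s : ℝ => L * Real.exp ((2 * s ^ 2 - 2 * s) * L) := by fun_prop
  rw [← intervalIntegral.integral_add_adjacent_intervals
    (hf.intervalIntegrable 0 (1 / 2)) (hf.intervalIntegrable (1 / 2) 1)]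
  have left := sub_le_integral_of_hasDerivAt_le (a := 0) (b := 1 / 2)
    (g := fun s => -(Real.exp (-2 * L * s) / 2)) (g' := fun s => L * Real.exp (-2 * L * s))
    (by norm_num) hf (by fun_prop)
    (fun x => by
      have := ((((hasDerivAt_id' x).const_mul (-2 * L)).exp).div_const 2).neg
      exact this.congr_deriv (by ring))
    (fun x _ => by
      refine mul_le_mul_of_nonneg_left (Real.exp_le_exp.mpr ?_) hL.le
      nlinarith [mul_nonneg hL.le (sq_nonneg x)])
  have right := sub_le_integral_of_hasDerivAt_le (a := 1 / 2) (b := 1)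
    (g := fun s => Real.exp (2 * L * (s - 1)) / 2) (g' := fun s => L * Real.exp (2 * L * (s - 1)))
    (by norm_num) hf (by fun_prop)
    (fun x => by
      have := ((((hasDerivAt_id' x).sub_const 1).const_mul (2 * L)).exp).div_const 2
      exact this.congr_deriv (by ring))
    (fun x _ => by
      refine mul_le_mul_of_nonneg_left (Real.exp_le_exp.mpr ?_) hL.le
      nlinarith [mul_nonneg hL.le (sq_nonneg (x - 1))])
  have e₁ : -2 * L * (1 / 2) = -L := by ring
  have e₂ : 2 * L * (1 / 2 - 1) = -L := by ring
  simp only [e₁, e₂, mul_zero, sub_self, Real.exp_zero] at left right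
  linarith
end

section
/- There exists a constant C > 0 such that for every bounded open set Ω ⊆ ℝ², every real α with 0 < α ≤ 4π, and every smooth function u : ℝ² → ℝ with compact support contained in Ω satisfying ∫_{ℝ²} |∇u(x)|² dx ≤ 1, one has ∫_Ω exp(α·u(x)²) dx ≤ C·|Ω| (the Trudinger–Moser inequality). -/
open MeasureTheory

section

open Set Filter Topology

/-- At a common point of differentiability, a finite-difference inequality passes to derivatives. -/
lemma mul_le_deriv_mul_deriv_of_slope {κ t d : ℝ} {m D : ℝ → ℝ} (hd : 0 < d)
    (hm : DifferentiableAt ℝ m t) (hD : DifferentiableAt ℝ D t)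
    (h : ∀ δ, 0 < δ → δ < d → κ * δ ^ 2 * m (t + δ) ≤ (m t - m (t + δ)) * (D t - D (t + δ))) :
    κ * m t ≤ deriv m t * deriv D t := by
  have h1 := hm.hasDerivAt.tendsto_slope_zero_right
  have h2 := hD.hasDerivAt.tendsto_slope_zero_right
  have h3 : Tendsto (fun δ => κ * m (t + δ)) (𝓝[>] 0) (𝓝 (κ * m t)) := by
    have : Tendsto (fun δ => κ * m (t + δ)) (𝓝 0) (𝓝 (κ * m (t + 0))) := by
      have hc : ContinuousAt m (t + 0) := by simpa using hm.continuousAt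
      have h4 : ContinuousAt (fun δ : ℝ => t + δ) 0 := by fun_prop
      exact (ContinuousAt.comp (f := fun δ : ℝ => t + δ) (g := m) hc h4).const_mul κ
    simpa using this.mono_left nhdsWithin_le_nhds
  refine le_of_tendsto_of_tendsto h3 (h1.mul h2) ?_
  filter_upwards [Ioo_mem_nhdsGT hd] with δ hδ
  have h5 := h δ hδ.1 hδ.2
  have h6 : (0 : ℝ) < δ := hδ.1
  simp only [smul_eq_mul]
  have : δ⁻¹ * (m (t + δ) - m t) * (δ⁻¹ * (D (t + δ) - D t))
      = (m t - m (t + δ)) * (D t - D (t + δ)) / δ ^ 2 := by field_simp; ring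
  rw [this, le_div_iff₀ (by positivity)]
  linarith

/-- A quadratic finite-difference inequality for two decreasing functions integrates to a
logarithmic one. -/
lemma mul_sq_le_log_mul_of_slope {κ a b : ℝ} {m D : ℝ → ℝ} (hκ : 0 ≤ κ) (hab : a ≤ b)
    (hm : AntitoneOn m (Icc a b)) (hD : AntitoneOn D (Icc a b)) (hmb : 0 < m b)
    (h : ∀ s ∈ Icc a b, ∀ t ∈ Icc a b, s < t →
      κ * (t - s) ^ 2 * m t ≤ (m s - m t) * (D s - D t)) :
    κ * (b - a) ^ 2 ≤ (Real.log (m a) - Real.log (m b)) * (D a - D b) := by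
  have hpos : ∀ t ∈ Icc a b, 0 < m t := fun t ht =>
    hmb.trans_le (hm ht (right_mem_Icc.2 hab) ht.2)
  have hlog : MonotoneOn (fun t => -Real.log (m t)) (Icc a b) := fun s hs t ht hst =>
    neg_le_neg (Real.log_le_log (hpos t ht) (hm hs ht hst))
  have key : ∀ x : ℝ, 0 ≤ x → 2 * Real.sqrt κ * x * (b - a) ≤
      x ^ 2 * (Real.log (m a) - Real.log (m b)) + (D a - D b) := by
    intro x hx
    set G : ℝ → ℝ := fun t => x ^ 2 * (-Real.log (m t)) + -D t with hG
    have hGm : MonotoneOn G (Icc a b) := fun s hs t ht hst =>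
      add_le_add (mul_le_mul_of_nonneg_left (hlog hs ht hst) (sq_nonneg x))
        (neg_le_neg (hD hs ht hst))
    rw [← uIcc_of_le hab] at hGm
    have hderiv := hGm.intervalIntegrable_deriv
    have hmem := hGm.intervalIntegral_deriv_mem_uIcc
    rw [uIcc_of_le hab] at hGm
    rw [uIcc_of_le (sub_nonneg.2 (hGm (left_mem_Icc.2 hab) (right_mem_Icc.2 hab) hab))] at hmem
    have hle : ∫ t in a..b, (2 * Real.sqrt κ * x) ≤ ∫ t in a..b, deriv G t := by
      refine intervalIntegral.integral_mono_ae_restrict hab (by simp) hderiv ?_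
      rw [← restrict_Ioo_eq_restrict_Icc]
      have e1 := (hm.neg.mono Ioo_subset_Icc_self).ae_differentiableWithinAt measurableSet_Ioo
      have e2 := (hD.neg.mono Ioo_subset_Icc_self).ae_differentiableWithinAt measurableSet_Ioo
      filter_upwards [e1, e2, ae_restrict_mem measurableSet_Ioo] with t h1 h2 ht
      have ht' := Ioo_subset_Icc_self ht
      have h1' : DifferentiableAt ℝ m t := by
        simpa using (h1.differentiableAt (Ioo_mem_nhds ht.1 ht.2)).neg
      have h2' : DifferentiableAt ℝ D t := by
        simpa using (h2.differentiableAt (Ioo_mem_nhds ht.1 ht.2)).neg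
      have h3 := mul_le_deriv_mul_deriv_of_slope (κ := κ) (sub_pos.2 ht.2) h1' h2' (by
        intro δ hδ hδ'
        have := h t ht' (t + δ) ⟨by linarith [ht.1], by linarith⟩ (by linarith)
        simpa using this)
      have hdm : deriv m t ≤ 0 := by
        have := (hm.neg).derivWithin_nonneg (x := t)
        rw [derivWithin_of_mem_nhds (Icc_mem_nhds ht.1 ht.2), deriv.fun_neg] at this
        linarith
      have hdD : deriv D t ≤ 0 := by
        have := (hD.neg).derivWithin_nonneg (x := t)
        rw [derivWithin_of_mem_nhds (Icc_mem_nhds ht.1 ht.2), deriv.fun_neg] at this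
        linarith
      have hmt := hpos t ht'
      have hGd : deriv G t = x ^ 2 * (-(deriv m t / m t)) + -deriv D t :=
        ((((h1'.hasDerivAt.log hmt.ne').neg).const_mul (x ^ 2)).add h2'.hasDerivAt.neg).deriv
      rw [hGd]
      set p := -(deriv m t / m t) with hp
      set q := -deriv D t with hq
      have hp0 : 0 ≤ p := by rw [hp]; exact neg_nonneg.2 (div_nonpos_of_nonpos_of_nonneg hdm hmt.le)
      have hq0 : 0 ≤ q := by linarith
      have hpq : κ ≤ p * q := by
        have : p * q = deriv m t * deriv D t / m t := by rw [hp, hq]; ring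
        rw [this, le_div_iff₀ hmt]; exact h3
      refine abs_le_of_sq_le_sq' ?_ (by positivity) |>.2
      have : (2 * Real.sqrt κ * x) ^ 2 = 4 * x ^ 2 * κ := by
        rw [mul_pow, mul_pow, Real.sq_sqrt hκ]; ring
      rw [this]
      nlinarith [sq_nonneg (x ^ 2 * p - q), mul_le_mul_of_nonneg_left hpq (sq_nonneg x)]
    rw [intervalIntegral.integral_const, smul_eq_mul] at hle
    have := hmem.2
    simp only [hG] at this hle
    linarith
  have hA : 0 ≤ Real.log (m a) - Real.log (m b) := by
    have := hlog (left_mem_Icc.2 hab) (right_mem_Icc.2 hab) hab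
    simp only at this; linarith
  have hB : 0 ≤ D a - D b := sub_nonneg.2 (hD (left_mem_Icc.2 hab) (right_mem_Icc.2 hab) hab)
  have hd := discrim_le_zero (a := Real.log (m a) - Real.log (m b))
    (b := -(2 * Real.sqrt κ * (b - a))) (c := D a - D b) (by
      intro x
      rcases le_total 0 x with hx | hx
      · nlinarith [key x hx]
      · have : 0 ≤ -(2 * Real.sqrt κ * (b - a)) * x :=
          mul_nonneg_of_nonpos_of_nonpos (neg_nonpos.2 (mul_nonneg (by positivity) (by linarith))) hx
        have := mul_nonneg hA (mul_self_nonneg x)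
        linarith)
  rw [discrim] at hd
  have : (-(2 * Real.sqrt κ * (b - a))) ^ 2 = 4 * (κ * (b - a) ^ 2) := by
    rw [neg_sq, mul_pow, mul_pow, Real.sq_sqrt hκ]; ring
  rw [this] at hd
  linarith

lemma mul_mul_sub_le_of_mul_sq_le {κ lam s t : ℝ} {L D : ℝ → ℝ} (hκ : 0 < κ)
    (hlam : 0 < lam) (hs : 0 < s) (hL : L s ≤ L t) (hD0 : 0 ≤ D t) (hD0' : 0 ≤ D s)
    (hD1 : D s ≤ 1) (hLs : 0 ≤ L s)
    (h : κ * (t - s) ^ 2 ≤ (L t - L s) * (D s - D t)) (h0 : κ * s ^ 2 ≤ L s * (1 - D s))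
    (hsE : L s ≤ κ * s ^ 2 + lam) (htE : L t ≤ κ * t ^ 2 + lam) :
    κ * s * (t - s) ≤ 3 * lam := by
  have h1 : κ * s ^ 2 ≤ L s := h0.trans (by nlinarith)
  have h2 : D s * (κ * s ^ 2 + lam) ≤ lam := by nlinarith
  have h3 : κ * (t - s) ^ 2 ≤ (κ * t ^ 2 + lam - κ * s ^ 2) * D s :=
    h.trans ((mul_le_mul_of_nonneg_left (by linarith : D s - D t ≤ D s) (by linarith)).trans
      (mul_le_mul_of_nonneg_right (by linarith) hD0'))
  have hP : 0 < κ * s ^ 2 + lam := by positivity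
  have h4 : κ * (t - s) ^ 2 * (κ * s ^ 2 + lam) ≤ (κ * t ^ 2 + lam - κ * s ^ 2) * lam := by
    refine (mul_le_mul_of_nonneg_right h3 hP.le).trans ?_
    rw [mul_assoc]
    exact mul_le_mul_of_nonneg_left h2 (by nlinarith)
  set X := κ * s * (t - s) with hX
  have h5 : X ^ 2 ≤ 2 * lam * X + lam ^ 2 := by
    rw [hX]; nlinarith
  by_contra! h6
  nlinarith

/-- The sublevel sets of `L t - κ t²` are covered by sets of weighted measure `O(lam)`. -/
lemma exists_measurableSet_superset_lintegral_le {κ lam : ℝ} {L D : ℝ → ℝ} {P : Set ℝ}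
    (hκ : 0 < κ) (hlam : 0 < lam) (hP : P ⊆ Ioi 0) (hL : MonotoneOn L P)
    (hL0 : ∀ t ∈ P, 0 ≤ L t) (hD0 : ∀ t ∈ P, 0 ≤ D t) (hD1 : ∀ t ∈ P, D t ≤ 1)
    (h : ∀ s ∈ P, ∀ t ∈ P, s ≤ t → κ * (t - s) ^ 2 ≤ (L t - L s) * (D s - D t))
    (h0 : ∀ t ∈ P, κ * t ^ 2 ≤ L t * (1 - D t)) :
    ∃ J : Set ℝ, MeasurableSet J ∧ {t ∈ P | L t ≤ κ * t ^ 2 + lam} ⊆ J ∧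
      ∫⁻ t in J, ENNReal.ofReal (2 * κ * t) ≤ ENNReal.ofReal (26 * lam) := by
  have hbd : ∀ a b c : ℝ, 0 ≤ b → 2 * κ * b * (b - a) ≤ c →
      ∫⁻ t in Icc a b, ENNReal.ofReal (2 * κ * t) ≤ ENNReal.ofReal c := by
    intro a b c hb hc
    calc ∫⁻ t in Icc a b, ENNReal.ofReal (2 * κ * t)
        ≤ ∫⁻ t in Icc a b, ENNReal.ofReal (2 * κ * b) :=
          setLIntegral_mono measurable_const fun t ht =>
            ENNReal.ofReal_le_ofReal (mul_le_mul_of_nonneg_left ht.2 (by positivity))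
      _ = ENNReal.ofReal (2 * κ * b * (b - a)) := by
          rw [setLIntegral_const, Real.volume_Icc, ← ENNReal.ofReal_mul (by positivity)]
      _ ≤ _ := ENNReal.ofReal_le_ofReal hc
  set E := {t ∈ P | L t ≤ κ * t ^ 2 + lam} with hE
  set q := Real.sqrt (lam / κ) with hq
  have hq0 : 0 < q := Real.sqrt_pos.2 (by positivity)
  have hq2 : κ * q ^ 2 = lam := by rw [hq, Real.sq_sqrt (by positivity)]; field_simp
  have hsmall : ∫⁻ t in Icc 0 q, ENNReal.ofReal (2 * κ * t) ≤ ENNReal.ofReal (2 * lam) :=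
    hbd _ _ _ hq0.le (by nlinarith)
  rcases (E ∩ Ioi q).eq_empty_or_nonempty with hemp | hne
  · refine ⟨Icc 0 q, measurableSet_Icc, fun t ht => ⟨le_of_lt (hP ht.1), ?_⟩,
      hsmall.trans (ENNReal.ofReal_le_ofReal (by linarith))⟩
    by_contra! hlt
    exact notMem_empty t (hemp ▸ ⟨ht, hlt⟩)
  · set a := sInf (E ∩ Ioi q) with ha
    have hbdd : BddBelow (E ∩ Ioi q) := ⟨q, fun t ht => le_of_lt ht.2⟩
    have hqa : q ≤ a := le_csInf hne fun t ht => le_of_lt ht.2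
    have ha0 : 0 < a := hq0.trans_le hqa
    set r := 3 * lam / (κ * a) with hr
    have hr0 : 0 < r := by positivity
    have hra : κ * a * r = 3 * lam := by rw [hr]; field_simp
    refine ⟨Icc 0 q ∪ Icc a (a + r), measurableSet_Icc.union measurableSet_Icc, ?_, ?_⟩
    · intro t ht
      rcases le_or_gt t q with htq | htq
      · exact Or.inl ⟨le_of_lt (hP ht.1), htq⟩
      · have hat : a ≤ t := csInf_le hbdd ⟨ht, htq⟩
        refine Or.inr ⟨hat, ?_⟩
        suffices t - r ≤ a by linarith
        refine le_csInf hne fun s hs => ?_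
        rcases le_total s t with hst | hst
        · have has : a ≤ s := csInf_le hbdd hs
          have h1 := mul_mul_sub_le_of_mul_sq_le hκ hlam (hP hs.1.1)
            (hL hs.1.1 ht.1 hst) (hD0 t ht.1) (hD0 s hs.1.1) (hD1 s hs.1.1) (hL0 s hs.1.1)
            (h s hs.1.1 t ht.1 hst) (h0 s hs.1.1) hs.1.2 ht.2
          have h2 : κ * a * (t - s) ≤ κ * a * r := by
            rw [hra]
            refine le_trans ?_ h1
            have := sub_nonneg.2 hst
            gcongr
          have := le_of_mul_le_mul_left h2 (by positivity)
          linarith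
        · linarith
    · refine (lintegral_union_le _ _ _).trans ?_
      have hlarge : ∫⁻ t in Icc a (a + r), ENNReal.ofReal (2 * κ * t)
          ≤ ENNReal.ofReal (24 * lam) := by
        refine hbd _ _ _ (by positivity) ?_
        have hra' : r ≤ 3 * a := by
          rw [hr, div_le_iff₀ (by positivity), ← hq2]
          have := mul_le_mul_of_nonneg_left (pow_le_pow_left₀ hq0.le hqa 2) hκ.le
          nlinarith
        nlinarith [mul_le_mul_of_nonneg_left hra' (mul_nonneg hκ.le hr0.le)]
      refine (add_le_add hsmall hlarge).trans ?_
      rw [← ENNReal.ofReal_add (by positivity) (by positivity)]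
      exact ENNReal.ofReal_le_ofReal (by linarith)

/-- The constant in the one-dimensional inequality `lintegral_mul_exp_sub_le`. -/
noncomputable def moserConst : ℝ := ∑' k : ℕ, 26 * ((k : ℝ) + 1) * Real.exp (-k)

lemma summable_moserConst : Summable fun k : ℕ => 26 * ((k : ℝ) + 1) * Real.exp (-k) := by
  have h1 := Real.summable_pow_mul_exp_neg_nat_mul 1 one_pos
  have h0 := Real.summable_pow_mul_exp_neg_nat_mul 0 one_pos
  refine ((h1.add h0).mul_left 26).congr fun k => ?_
  simp only [pow_one, pow_zero, neg_mul, one_mul]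
  ring

/-- The one-dimensional inequality behind the Trudinger-Moser inequality. -/
lemma lintegral_mul_exp_sub_le {κ : ℝ} {L D : ℝ → ℝ} {P : Set ℝ}
    (hκ : 0 < κ) (hP : P ⊆ Ioi 0) (hL : MonotoneOn L P)
    (hL0 : ∀ t ∈ P, 0 ≤ L t) (hD0 : ∀ t ∈ P, 0 ≤ D t) (hD1 : ∀ t ∈ P, D t ≤ 1)
    (h : ∀ s ∈ P, ∀ t ∈ P, s ≤ t → κ * (t - s) ^ 2 ≤ (L t - L s) * (D s - D t))
    (h0 : ∀ t ∈ P, κ * t ^ 2 ≤ L t * (1 - D t)) :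
    ∫⁻ t, P.indicator (fun t => ENNReal.ofReal (2 * κ * t * Real.exp (κ * t ^ 2 - L t))) t
      ≤ ENNReal.ofReal moserConst := by
  choose! J hJm hJ hJi using fun k : ℕ => exists_measurableSet_superset_lintegral_le
    (lam := (k : ℝ) + 1) hκ (by positivity) hP hL hL0 hD0 hD1 h h0
  have hpt : ∀ t, P.indicator (fun t => ENNReal.ofReal (2 * κ * t * Real.exp (κ * t ^ 2 - L t))) t
      ≤ ∑' k : ℕ, ENNReal.ofReal (Real.exp (-k)) *
        (J k).indicator (fun t => ENNReal.ofReal (2 * κ * t)) t := by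
    intro t
    by_cases ht : t ∈ P
    · rw [indicator_of_mem ht]
      have hx : 0 ≤ L t - κ * t ^ 2 := by
        have := h0 t ht
        have := mul_nonneg (hL0 t ht) (hD0 t ht)
        linarith
      set k := ⌊L t - κ * t ^ 2⌋₊
      have hk1 : (k : ℝ) ≤ L t - κ * t ^ 2 := Nat.floor_le hx
      have hk2 : L t - κ * t ^ 2 < k + 1 := Nat.lt_floor_add_one _
      have htJ : t ∈ J k := hJ k ⟨ht, by linarith⟩
      refine le_trans ?_ (ENNReal.le_tsum k)
      have ht0 : (0 : ℝ) < t := hP ht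
      rw [indicator_of_mem htJ, ← ENNReal.ofReal_mul (Real.exp_nonneg _)]
      refine ENNReal.ofReal_le_ofReal ?_
      rw [mul_comm]
      gcongr
      linarith
    · simp [indicator_of_notMem ht]
  refine (lintegral_mono hpt).trans ?_
  have hmeas : ∀ k, Measurable ((J k).indicator (fun t => ENNReal.ofReal (2 * κ * t))) :=
    fun k => Measurable.indicator (by fun_prop) (hJm k)
  rw [lintegral_tsum fun k => ((hmeas k).const_mul _).aemeasurable, moserConst,
    ENNReal.ofReal_tsum_of_nonneg (fun k => by positivity) summable_moserConst]
  refine ENNReal.tsum_le_tsum fun k => ?_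
  rw [lintegral_const_mul _ (hmeas k), lintegral_indicator (hJm k), mul_comm,
    ENNReal.ofReal_mul (by positivity)]
  gcongr
  exact hJi k

/-- The one-dimensional Brunn-Minkowski inequality. -/
lemma Real.volume_add_volume_le_of_add_mem {X Y Z : Set ℝ} (hX : MeasurableSet X)
    (hY : MeasurableSet Y) (hXn : X.Nonempty) (hYn : Y.Nonempty)
    (h : ∀ x ∈ X, ∀ y ∈ Y, x + y ∈ Z) : volume X + volume Y ≤ volume Z := by
  have hl : ∀ (x : ℝ) (K : Set ℝ), volume ((fun y => x + y) '' K) = volume K := fun x K => by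
    simp
  have key : ∀ K, (K ⊆ X ∧ IsCompact K) → ∀ K', (K' ⊆ Y ∧ IsCompact K') →
      volume K + volume K' ≤ volume Z := by
    rintro K ⟨hKX, hK⟩ K' ⟨hKY, hK'⟩
    rcases K.eq_empty_or_nonempty with rfl | hKn
    · obtain ⟨x, hx⟩ := hXn
      rw [measure_empty, zero_add, ← hl x K']
      exact measure_mono (image_subset_iff.2 fun y hy => h x hx y (hKY hy))
    rcases K'.eq_empty_or_nonempty with rfl | hKn'
    · obtain ⟨y, hy⟩ := hYn
      rw [measure_empty, add_zero, ← hl y K]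
      refine measure_mono (image_subset_iff.2 fun x hx => ?_)
      rw [mem_preimage, add_comm]
      exact h x (hKX hx) y hy
    obtain ⟨a, haK, ha⟩ := hK.exists_isGreatest hKn
    obtain ⟨b, hbK, hb⟩ := hK'.exists_isLeast hKn'
    rw [← hl b K, ← hl a K']
    have hd : AEDisjoint volume ((fun y => b + y) '' K) ((fun y => a + y) '' K') := by
      refine measure_mono_null ?_ (measure_singleton (a + b))
      rintro _ ⟨⟨x, hx, rfl⟩, ⟨y, hy, hxy⟩⟩
      have h1 := ha hx
      have h2 := hb hy
      simp only at hxy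
      rw [mem_singleton_iff]
      linarith
    rw [← measure_union₀ (hK'.image (by fun_prop)).measurableSet.nullMeasurableSet hd]
    refine measure_mono (union_subset (image_subset_iff.2 fun x hx => ?_)
      (image_subset_iff.2 fun y hy => h a (hKX haK) y (hKY hy)))
    rw [mem_preimage, add_comm]
    exact h x (hKX hx) b (hKY hbK)
  rw [hX.measure_eq_iSup_isCompact, hY.measure_eq_iSup_isCompact]
  simp_rw [iSup_and']
  exact ENNReal.biSup_add_biSup_le' ⟨∅, empty_subset _, isCompact_empty⟩
    ⟨∅, empty_subset _, isCompact_empty⟩ key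

/-- A bounded nonnegative function scaled to have supremum one, in layer-cake form. -/
lemma lintegral_ofReal_div_eq_setLIntegral_Ioo {a : ℝ → ℝ} {M : ℝ} (ha : Measurable a)
    (ha0 : ∀ x, 0 ≤ a x) (hM : 0 < M) (haM : ∀ x, a x ≤ M) :
    ∫⁻ x, ENNReal.ofReal (a x / M) = ∫⁻ s in Ioo (0 : ℝ) 1, volume {x | s * M < a x} := by
  rw [lintegral_eq_lintegral_meas_lt volume (ae_of_all _ fun x => div_nonneg (ha0 x) hM.le)
    (ha.div_const M).aemeasurable]
  simp_rw [lt_div_iff₀ hM]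
  symm
  rw [← lintegral_indicator measurableSet_Ioo, ← lintegral_indicator measurableSet_Ioi]
  refine lintegral_congr fun s => ?_
  by_cases hs1 : s ∈ Ioo (0 : ℝ) 1
  · rw [indicator_of_mem hs1, indicator_of_mem (show s ∈ Ioi (0 : ℝ) from hs1.1)]
  rw [indicator_of_notMem hs1]
  by_cases hs0 : s ∈ Ioi (0 : ℝ)
  swap
  · rw [indicator_of_notMem hs0]
  rw [indicator_of_mem hs0]
  symm
  have h1 : 1 ≤ s := by
    by_contra! hlt
    exact hs1 ⟨hs0, hlt⟩
  convert measure_empty (μ := (volume : Measure ℝ))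
  refine eq_empty_of_forall_notMem fun x hx => ?_
  have := haM x
  have h2 : s * M < a x := hx
  nlinarith

lemma lintegral_add_lintegral_le_of_superadditive {a b c : ℝ → ℝ} {M N : ℝ}
    (ha : Measurable a) (hb : Measurable b) (hc : Measurable c)
    (ha0 : ∀ x, 0 ≤ a x) (hb0 : ∀ x, 0 ≤ b x) (hc0 : ∀ x, 0 ≤ c x)
    (hM : 0 < M) (hN : 0 < N) (haM : IsLUB (range a) M) (hbN : IsLUB (range b) N)
    (h : ∀ x y, 0 < a x → 0 < b y → a x + b y ≤ c (x + y)) :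
    (∫⁻ x, ENNReal.ofReal (a x / M)) + ∫⁻ x, ENNReal.ofReal (b x / N) ≤
      ∫⁻ x, ENNReal.ofReal (c x / (M + N)) := by
  rw [lintegral_ofReal_div_eq_setLIntegral_Ioo ha ha0 hM fun x => haM.1 ⟨x, rfl⟩,
    lintegral_ofReal_div_eq_setLIntegral_Ioo hb hb0 hN fun x => hbN.1 ⟨x, rfl⟩,
    lintegral_eq_lintegral_meas_lt volume
      (ae_of_all _ fun x => div_nonneg (hc0 x) (by positivity : 0 ≤ M + N))
      (hc.div_const _).aemeasurable]
  simp_rw [lt_div_iff₀ (by positivity : 0 < M + N)]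
  have hanti : Antitone fun s : ℝ => volume {x | s * M < a x} := fun s t hst =>
    measure_mono fun x hx => (mul_le_mul_of_nonneg_right hst hM.le).trans_lt hx
  rw [← lintegral_add_left hanti.measurable]
  refine (setLIntegral_mono' measurableSet_Ioo fun s hs => ?_).trans
    (lintegral_mono_set fun s hs => hs.1)
  refine Real.volume_add_volume_le_of_add_mem (measurableSet_lt measurable_const ha)
    (measurableSet_lt measurable_const hb) ?_ ?_ ?_
  · obtain ⟨_, ⟨x, rfl⟩, hx, -⟩ := haM.exists_between (by nlinarith [hs.2] : s * M < M)
    exact ⟨x, hx⟩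
  · obtain ⟨_, ⟨x, rfl⟩, hx, -⟩ := hbN.exists_between (by nlinarith [hs.2] : s * N < N)
    exact ⟨x, hx⟩
  · intro x (hx : s * M < a x) y (hy : s * N < b y)
    have h1 := h x y ((mul_pos hs.1 hM).trans hx) ((mul_pos hs.1 hN).trans hy)
    show s * (M + N) < c (x + y)
    linarith

lemma volume_section_lt_top {A : Set (ℝ × ℝ)} (hA : IsCompact A) :
    ∃ B : ℝ, ∀ x, volume (Prod.mk x ⁻¹' A) ≤ ENNReal.ofReal B := by
  have h := (hA.image continuous_snd)
  refine ⟨(volume (Prod.snd '' A)).toReal, fun x => ?_⟩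
  rw [ENNReal.ofReal_toReal h.measure_lt_top.ne]
  exact measure_mono fun y hy => ⟨(x, y), hy, rfl⟩

lemma sections_of_isCompact {A : Set (ℝ × ℝ)} (hA : IsCompact A) :
    ∃ a : ℝ → ℝ, Measurable a ∧ (∀ x, 0 ≤ a x) ∧ BddAbove (range a) ∧
      (∀ x, volume (Prod.mk x ⁻¹' A) = ENNReal.ofReal (a x)) ∧
      volume A = ∫⁻ x, ENNReal.ofReal (a x) := by
  obtain ⟨B, hB⟩ := volume_section_lt_top hA
  have e : ∀ x, volume (Prod.mk x ⁻¹' A) = ENNReal.ofReal (volume (Prod.mk x ⁻¹' A)).toReal :=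
    fun x => (ENNReal.ofReal_toReal ((hB x).trans_lt ENNReal.ofReal_lt_top).ne).symm
  refine ⟨fun x => (volume (Prod.mk x ⁻¹' A)).toReal,
    (measurable_measure_prodMk_left hA.measurableSet).ennreal_toReal,
    fun x => ENNReal.toReal_nonneg, ⟨(ENNReal.ofReal B).toReal, ?_⟩, e, ?_⟩
  · rintro _ ⟨x, rfl⟩
    exact ENNReal.toReal_mono ENNReal.ofReal_ne_top (hB x)
  · rw [Measure.volume_eq_prod, Measure.prod_apply hA.measurableSet]
    exact lintegral_congr e

lemma isLUB_sup_pos_of_lintegral_pos {a : ℝ → ℝ} (ha : BddAbove (range a))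
    (h : ∫⁻ x, ENNReal.ofReal (a x) ≠ 0) :
    ∃ M, 0 < M ∧ IsLUB (range a) M := by
  refine ⟨sSup (range a), ?_, isLUB_csSup (range_nonempty a) ha⟩
  by_contra! hle
  refine h ?_
  have : ∀ x, ENNReal.ofReal (a x) = 0 := fun x =>
    ENNReal.ofReal_eq_zero.2 ((le_csSup ha ⟨x, rfl⟩).trans hle)
  simp [this]

lemma lintegral_ofReal_div {a : ℝ → ℝ} {M : ℝ} (hM : 0 < M) (ha : Measurable a) :
    ∫⁻ x, ENNReal.ofReal (a x / M) = (∫⁻ x, ENNReal.ofReal (a x)) * ENNReal.ofReal M⁻¹ := by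
  rw [← lintegral_mul_const _ (by fun_prop)]
  refine lintegral_congr fun x => ?_
  rw [div_eq_mul_inv, ENNReal.ofReal_mul' (by positivity)]

open Pointwise in
/-- The planar Brunn-Minkowski inequality for compact sets. -/
lemma volume_add_volume_add_two_mul_sqrt_le {A B : Set (ℝ × ℝ)} (hA : IsCompact A)
    (hB : IsCompact B) (hA0 : volume A ≠ 0) (hB0 : volume B ≠ 0) :
    (volume A).toReal + (volume B).toReal
      + 2 * Real.sqrt ((volume A).toReal * (volume B).toReal) ≤ (volume (A + B)).toReal := by
  obtain ⟨a, ham, ha0, hab, hae, hai⟩ := sections_of_isCompact hA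
  obtain ⟨b, hbm, hb0, hbb, hbe, hbi⟩ := sections_of_isCompact hB
  obtain ⟨c, hcm, hc0, -, hce, hci⟩ := sections_of_isCompact (hA.add hB)
  obtain ⟨M, hM, haM⟩ := isLUB_sup_pos_of_lintegral_pos hab (hai ▸ hA0)
  obtain ⟨N, hN, hbN⟩ := isLUB_sup_pos_of_lintegral_pos hbb (hbi ▸ hB0)
  have key := lintegral_add_lintegral_le_of_superadditive ham hbm hcm ha0 hb0 hc0 hM hN haM hbN (by
    intro x y hx hy
    have h1 : (Prod.mk x ⁻¹' A).Nonempty := by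
      refine nonempty_of_measure_ne_zero (μ := volume) ?_
      rw [hae]; simpa using hx
    have h2 : (Prod.mk y ⁻¹' B).Nonempty := by
      refine nonempty_of_measure_ne_zero (μ := volume) ?_
      rw [hbe]; simpa using hy
    have h3 := Real.volume_add_volume_le_of_add_mem (Z := Prod.mk (x + y) ⁻¹' (A + B))
      (measurable_prodMk_left hA.measurableSet) (measurable_prodMk_left hB.measurableSet) h1 h2
      (fun s hs t ht => Set.mem_add.2 ⟨(x, s), hs, (y, t), ht, rfl⟩)
    rw [hae, hbe, hce, ← ENNReal.ofReal_add (ha0 x) (hb0 y),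
      ENNReal.ofReal_le_ofReal_iff (hc0 _)] at h3
    exact h3)
  rw [lintegral_ofReal_div hM ham, lintegral_ofReal_div hN hbm,
    lintegral_ofReal_div (by positivity) hcm, ← hai, ← hbi, ← hci] at key
  have hAt := hA.measure_lt_top (μ := volume).ne
  have hBt := hB.measure_lt_top (μ := volume).ne
  have hCt := (hA.add hB).measure_lt_top (μ := volume).ne
  have key' := ENNReal.toReal_mono (ENNReal.mul_ne_top hCt ENNReal.ofReal_ne_top) key
  rw [ENNReal.toReal_add (ENNReal.mul_ne_top hAt ENNReal.ofReal_ne_top)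
    (ENNReal.mul_ne_top hBt ENNReal.ofReal_ne_top), ENNReal.toReal_mul, ENNReal.toReal_mul,
    ENNReal.toReal_mul, ENNReal.toReal_ofReal (by positivity),
    ENNReal.toReal_ofReal (by positivity), ENNReal.toReal_ofReal (by positivity)] at key'
  set p := (volume A).toReal
  set q := (volume B).toReal
  have hp : 0 ≤ p := ENNReal.toReal_nonneg
  have hq : 0 ≤ q := ENNReal.toReal_nonneg
  rw [← div_eq_mul_inv, ← div_eq_mul_inv, ← div_eq_mul_inv, le_div_iff₀ (by positivity)] at key'
  refine le_trans ?_ key'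
  have e : (p / M + q / N) * (M + N) = p + q + (p * N / M + q * M / N) := by field_simp; ring
  rw [e]
  refine add_le_add_right ?_ _
  refine abs_le_of_sq_le_sq' ?_ (by positivity) |>.2
  rw [mul_pow, Real.sq_sqrt (by positivity)]
  have e2 : p * q = (p * N / M) * (q * M / N) := by field_simp
  rw [e2]
  nlinarith [sq_nonneg (p * N / M - q * M / N)]

open Pointwise in
lemma EuclideanSpace.volume_add_volume_add_two_mul_sqrt_le {A B : Set (EuclideanSpace ℝ (Fin 2))}
    (hA : IsCompact A) (hB : IsCompact B) (hA0 : volume A ≠ 0) (hB0 : volume B ≠ 0) :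
    (volume A).toReal + (volume B).toReal
      + 2 * Real.sqrt ((volume A).toReal * (volume B).toReal) ≤ (volume (A + B)).toReal := by
  set e : EuclideanSpace ℝ (Fin 2) ≃ᵐ ℝ × ℝ :=
    (MeasurableEquiv.toLp 2 (Fin 2 → ℝ)).symm.trans MeasurableEquiv.finTwoArrow with he
  have hmp : MeasurePreserving e := (PiLp.volume_preserving_ofLp (Fin 2)).trans
    (volume_preserving_finTwoArrow ℝ)
  have hex : ∀ x, e x = (x 0, x 1) := fun x => rfl
  have hc : Continuous e := by
    have : (e : EuclideanSpace ℝ (Fin 2) → ℝ × ℝ) = fun x => (x 0, x 1) := funext hex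
    rw [this]
    fun_prop
  have hvol : ∀ S, volume (e '' S) = volume S := fun S => by
    rw [← hmp.measure_preimage_equiv, e.injective.preimage_image]
  have hadd : e '' (A + B) = e '' A + e '' B := image_image2_distrib fun x y => by
    simp [hex]
  have := _root_.volume_add_volume_add_two_mul_sqrt_le (hA.image hc) (hB.image hc)
    (by rwa [hvol]) (by rwa [hvol])
  rwa [← hadd, hvol, hvol, hvol] at this

open Pointwise in
/-- The isoperimetric inequality for parallel sets in the plane. -/
lemma volume_add_le_volume_cthickening {A : Set (EuclideanSpace ℝ (Fin 2))} {r : ℝ}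
    (hA : IsCompact A) (hr : 0 < r) :
    volume A + ENNReal.ofReal (2 * r * Real.sqrt (Real.pi * (volume A).toReal)) ≤
      volume (Metric.cthickening r A) := by
  by_cases hA0 : volume A = 0
  · simp [hA0]
  have hB : volume (Metric.closedBall (0 : EuclideanSpace ℝ (Fin 2)) r)
      = ENNReal.ofReal (r ^ 2 * Real.pi) := by
    rw [EuclideanSpace.volume_closedBall_fin_two, ENNReal.ofReal_mul (by positivity),
      ENNReal.ofReal_pow hr.le]
  have hpi := Real.pi_pos
  have key := EuclideanSpace.volume_add_volume_add_two_mul_sqrt_le hA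
    (isCompact_closedBall (0 : EuclideanSpace ℝ (Fin 2)) r) hA0
    (by rw [hB]; simp; positivity)
  rw [hB, ENNReal.toReal_ofReal (by positivity)] at key
  have hs : Real.sqrt ((volume A).toReal * (r ^ 2 * Real.pi))
      = r * Real.sqrt (Real.pi * (volume A).toReal) := by
    rw [show (volume A).toReal * (r ^ 2 * Real.pi) = r ^ 2 * (Real.pi * (volume A).toReal) by ring,
      Real.sqrt_mul (by positivity), Real.sqrt_sq hr.le]
  rw [hs] at key
  rw [hA.cthickening_eq_biUnion_closedBall hr.le]
  refine le_trans ?_ (measure_mono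
    (s := A + Metric.closedBall (0 : EuclideanSpace ℝ (Fin 2)) r) ?_)
  · rw [← ENNReal.ofReal_toReal hA.measure_lt_top.ne, ← ENNReal.ofReal_toReal
      (hA.add (isCompact_closedBall (0 : EuclideanSpace ℝ (Fin 2)) r)).measure_lt_top.ne,
      ENNReal.toReal_ofReal ENNReal.toReal_nonneg,
      ← ENNReal.ofReal_add ENNReal.toReal_nonneg (by positivity)]
    refine ENNReal.ofReal_le_ofReal (le_trans ?_ key)
    have : 0 ≤ r ^ 2 * Real.pi := by positivity
    linarith
  · rintro _ ⟨x, hx, y, hy, rfl⟩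
    simp only [mem_iUnion]
    exact ⟨x, hx, by simpa using hy⟩

/-- The supremum of a function over closed balls of a fixed radius. -/
noncomputable def ballSup {E : Type*} [PseudoMetricSpace E] (u : E → ℝ) (r : ℝ) (x : E) : ℝ :=
  sSup (u '' Metric.closedBall x r)

lemma exists_ballSup_eq {E : Type*} [PseudoMetricSpace E] [ProperSpace E] {u : E → ℝ}
    (hu : Continuous u) {r : ℝ} (hr : 0 ≤ r) (x : E) :
    ∃ y ∈ Metric.closedBall x r, ballSup u r x = u y ∧ ∀ z ∈ Metric.closedBall x r, u z ≤ u y := by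
  obtain ⟨y, hy, hmax⟩ := (isCompact_closedBall x r).exists_isMaxOn
    ⟨x, Metric.mem_closedBall_self hr⟩ hu.continuousOn
  refine ⟨y, hy, ?_, fun z hz => hmax hz⟩
  exact IsGreatest.csSup_eq ⟨mem_image_of_mem u hy, by rintro _ ⟨z, hz, rfl⟩; exact hmax hz⟩

lemma le_ballSup_iff {E : Type*} [PseudoMetricSpace E] [ProperSpace E] {u : E → ℝ}
    (hu : Continuous u) {r s : ℝ} (hr : 0 ≤ r) (hs : IsCompact {y | s ≤ u y}) (x : E) :
    s ≤ ballSup u r x ↔ x ∈ Metric.cthickening r {y | s ≤ u y} := by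
  obtain ⟨y, hy, hxy, hmax⟩ := exists_ballSup_eq hu hr x
  rw [hs.cthickening_eq_biUnion_closedBall hr, hxy]
  simp only [mem_iUnion, mem_ofPred_eq, exists_prop]
  constructor
  · exact fun h => ⟨y, h, by rwa [Metric.mem_closedBall_comm]⟩
  · rintro ⟨z, hz, hxz⟩
    exact hz.trans (hmax z (by rwa [Metric.mem_closedBall_comm]))

/-- Truncation of a real number to the window `[t, t + h]`, shifted to start at zero. -/
noncomputable def window (t h v : ℝ) : ℝ := min h (max 0 (v - t))

lemma window_nonneg {t h v : ℝ} (hh : 0 ≤ h) : 0 ≤ window t h v := le_min hh (le_max_left _ _)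

lemma window_le {t h v : ℝ} : window t h v ≤ h := min_le_left _ _

lemma le_window_iff {t h v s : ℝ} (hs : 0 < s) : s ≤ window t h v ↔ s ≤ h ∧ t + s ≤ v := by
  rw [window, le_min_iff, le_max_iff]
  constructor
  · rintro ⟨h1, h2 | h2⟩
    · linarith
    · exact ⟨h1, by linarith⟩
  · exact fun h1 => ⟨h1.1, Or.inr (by linarith [h1.2])⟩

lemma window_eq_zero {t h v : ℝ} (hh : 0 ≤ h) (hv : v ≤ t) : window t h v = 0 := by
  rw [window, max_eq_left (by linarith), min_eq_right hh]

lemma window_eq {t h v : ℝ} (hh : 0 ≤ h) (hv : t + h ≤ v) : window t h v = h := by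
  rw [window, max_eq_right (by linarith), min_eq_left (by linarith)]

lemma window_mono {t h : ℝ} : Monotone (window t h) := fun a b hab => by
  unfold window; gcongr

lemma window_sub_le {t h a b : ℝ} (hab : a ≤ b) : window t h b - window t h a ≤ b - a := by
  unfold window
  rcases min_cases h (max 0 (b - t)) with ⟨h1, _⟩ | ⟨h1, _⟩ <;>
  rcases min_cases h (max 0 (a - t)) with ⟨h2, _⟩ | ⟨h2, _⟩ <;>
  rcases max_cases 0 (b - t) with ⟨h3, _⟩ | ⟨h3, _⟩ <;>
  rcases max_cases 0 (a - t) with ⟨h4, _⟩ | ⟨h4, _⟩ <;> linarith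

lemma measurable_window_ballSup {E : Type*} [PseudoMetricSpace E] [ProperSpace E]
    [MeasurableSpace E] [OpensMeasurableSpace E] {u : E → ℝ} (hu : Continuous u)
    (hc : ∀ s, 0 < s → IsCompact {y | s ≤ u y}) {t h r : ℝ} (ht : 0 < t) (hh : 0 ≤ h)
    (hr : 0 ≤ r) : Measurable fun x => window t h (ballSup u r x) := by
  refine measurable_of_Ici fun s => ?_
  rcases le_or_gt s 0 with hs | hs
  · convert MeasurableSet.univ
    exact eq_univ_of_forall fun x => hs.trans (window_nonneg hh)
  · have : (fun x => window t h (ballSup u r x)) ⁻¹' Ici s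
        = {x | s ≤ h ∧ x ∈ Metric.cthickening r {y | t + s ≤ u y}} := by
      ext x
      rw [mem_preimage, mem_Ici, le_window_iff hs, le_ballSup_iff hu hr (hc _ (by linarith))]
      rfl
    rw [this, ofPred_and]
    exact (MeasurableSet.const _).inter Metric.isClosed_cthickening.measurableSet

lemma lintegral_window_add_le {u : EuclideanSpace ℝ (Fin 2) → ℝ} (hu : Continuous u)
    (hc : ∀ s, 0 < s → IsCompact {y | s ≤ u y}) {t h r : ℝ} (ht : 0 < t) (hh : 0 ≤ h)
    (hr : 0 < r) :
    (∫⁻ x, ENNReal.ofReal (window t h (u x))) + ENNReal.ofReal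
      (2 * r * Real.sqrt (Real.pi * (volume {x | t + h ≤ u x}).toReal)) * ENNReal.ofReal h ≤
      ∫⁻ x, ENNReal.ofReal (window t h (ballSup u r x)) := by
  have hwm : Measurable fun x => window t h (u x) := by
    unfold window
    have := hu.measurable
    fun_prop
  rw [lintegral_eq_lintegral_meas_le volume (ae_of_all _ fun x => window_nonneg hh)
    hwm.aemeasurable, lintegral_eq_lintegral_meas_le volume (ae_of_all _ fun x => window_nonneg hh)
    (measurable_window_ballSup hu hc ht hh hr.le).aemeasurable]
  set κ := ENNReal.ofReal (2 * r * Real.sqrt (Real.pi * (volume {x | t + h ≤ u x}).toReal)) with hκ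
  have e : κ * ENNReal.ofReal h = ∫⁻ s in Ioi (0 : ℝ), (Ioc 0 h).indicator (fun _ => κ) s := by
    rw [lintegral_indicator_const measurableSet_Ioc, Measure.restrict_apply measurableSet_Ioc,
      inter_eq_left.2 fun s hs => hs.1, Real.volume_Ioc, sub_zero]
  rw [e, ← lintegral_add_right _ (measurable_const.indicator measurableSet_Ioc)]
  refine setLIntegral_mono' measurableSet_Ioi fun s (hs : 0 < s) => ?_
  simp_rw [le_window_iff hs]
  by_cases hsh : s ≤ h
  · rw [indicator_of_mem (show s ∈ Ioc 0 h from ⟨hs, hsh⟩)]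
    have hcs := hc (t + s) (by linarith)
    simp_rw [le_ballSup_iff hu hr.le hcs]
    simp only [hsh, true_and, ofPred_mem_eq]
    refine le_trans ?_ (volume_add_le_volume_cthickening hcs hr)
    rw [hκ]
    gcongr
    exact hcs.measure_lt_top.ne
  · simp [hsh]

lemma isCompact_superlevel {E : Type*} [TopologicalSpace E] {u : E → ℝ} (hu : Continuous u)
    (hc : HasCompactSupport u) {s : ℝ} (hs : 0 < s) : IsCompact {y | s ≤ u y} := by
  refine hc.of_isClosed_subset (isClosed_le continuous_const hu) fun y hy => ?_
  refine subset_tsupport u ?_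
  have h : s ≤ u y := hy
  rw [Function.mem_support]
  linarith

lemma ofReal_window_diff_le {u : EuclideanSpace ℝ (Fin 2) → ℝ} (hu : Continuous u)
    (hs : HasCompactSupport u) {t h r : ℝ} (ht : 0 < t) (hh : 0 ≤ h) (hr : 0 < r) :
    ENNReal.ofReal (2 * h * Real.sqrt (Real.pi * (volume {x | t + h ≤ u x}).toReal)) ≤
      ∫⁻ x, ENNReal.ofReal ((window t h (ballSup u r x) - window t h (u x)) / r) := by
  have hc : ∀ s, 0 < s → IsCompact {y | s ≤ u y} := fun s h0 => isCompact_superlevel hu hs h0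
  have key := lintegral_window_add_le hu hc ht hh hr
  have hwm : Measurable fun x => window t h (u x) := by
    unfold window
    have := hu.measurable
    fun_prop
  have hWm := measurable_window_ballSup hu hc ht hh hr.le
  have hfin : ∫⁻ x, ENNReal.ofReal (window t h (u x)) ≠ ⊤ := by
    refine ne_top_of_le_ne_top (b := ∫⁻ x, {x | t ≤ u x}.indicator (fun _ => ENNReal.ofReal h) x)
      ?_ (lintegral_mono fun x => ?_)
    · rw [lintegral_indicator_const (hc t ht).measurableSet]
      exact ENNReal.mul_ne_top ENNReal.ofReal_ne_top (hc t ht).measure_lt_top.ne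
    · by_cases hx : t ≤ u x
      · rw [indicator_of_mem (show x ∈ {x | t ≤ u x} from hx)]
        exact ENNReal.ofReal_le_ofReal window_le
      · rw [window_eq_zero hh (not_le.1 hx).le]
        simp
  have hdiff : ∀ x, 0 ≤ window t h (ballSup u r x) - window t h (u x) := fun x => by
    obtain ⟨y, hy, hxy, hmax⟩ := exists_ballSup_eq hu hr.le x
    rw [hxy]
    exact sub_nonneg.2 (window_mono (hmax x (Metric.mem_closedBall_self hr.le)))
  have hsum : ∫⁻ x, ENNReal.ofReal (window t h (ballSup u r x)) =
      (∫⁻ x, ENNReal.ofReal (window t h (u x))) +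
      ∫⁻ x, ENNReal.ofReal (window t h (ballSup u r x) - window t h (u x)) := by
    rw [← lintegral_add_left (by fun_prop)]
    refine lintegral_congr fun x => ?_
    rw [← ENNReal.ofReal_add (window_nonneg hh) (hdiff x)]
    congr 1
    ring
  rw [hsum, ENNReal.add_le_add_iff_left hfin] at key
  have e : ∫⁻ x, ENNReal.ofReal ((window t h (ballSup u r x) - window t h (u x)) / r) =
      (∫⁻ x, ENNReal.ofReal (window t h (ballSup u r x) - window t h (u x)))
        * ENNReal.ofReal r⁻¹ := by
    rw [← lintegral_mul_const _ (by fun_prop)]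
    refine lintegral_congr fun x => ?_
    rw [div_eq_mul_inv, ENNReal.ofReal_mul' (by positivity)]
  rw [e]
  refine le_trans (le_of_eq ?_) (mul_le_mul_left key _)
  rw [← ENNReal.ofReal_mul (by positivity), ← ENNReal.ofReal_mul (by positivity)]
  congr 1
  field_simp

lemma limsup_window_diff_le {E : Type*} [NormedAddCommGroup E] [NormedSpace ℝ E] [ProperSpace E]
    {u : E → ℝ} (hu : Continuous u)
    {t h : ℝ} (hh : 0 ≤ h) {x : E} (hd : DifferentiableAt ℝ u x) {r : ℕ → ℝ}
    (hr : ∀ n, 0 < r n) (hr0 : Tendsto r atTop (𝓝 0)) :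
    limsup (fun n => ENNReal.ofReal
      ((window t h (ballSup u (r n) x) - window t h (u x)) / r n)) atTop ≤
      {x | t ≤ u x ∧ u x < t + h}.indicator (fun x => ENNReal.ofReal ‖fderiv ℝ u x‖) x := by
  have hsmall : ∀ p : E → Prop, (∀ᶠ y in 𝓝 x, p y) →
      ∀ᶠ n in atTop, ∀ y ∈ Metric.closedBall x (r n), p y := by
    intro p hp
    obtain ⟨δ, hδ, hball⟩ := Metric.eventually_nhds_iff_ball.1 hp
    filter_upwards [hr0.eventually_lt_const hδ] with n hn y hy
    exact hball y (Metric.closedBall_subset_ball hn hy)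
  by_cases hx : t ≤ u x ∧ u x < t + h
  · rw [indicator_of_mem (show x ∈ {x | t ≤ u x ∧ u x < t + h} from hx)]
    refine ENNReal.le_of_forall_pos_le_add fun ε hε _ => ?_
    refine limsup_le_of_le (by isBoundedDefault) ?_
    have hlit := hd.hasFDerivAt.isLittleO.def (show (0 : ℝ) < ε from hε)
    filter_upwards [hsmall _ hlit] with n hn
    obtain ⟨y, hy, hxy, hmax⟩ := exists_ballSup_eq hu (hr n).le x
    have h1 : u x ≤ u y := hmax x (Metric.mem_closedBall_self (hr n).le)
    have h2 := hn y hy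
    rw [← ENNReal.ofReal_coe_nnreal, ← ENNReal.ofReal_add (norm_nonneg _) ε.coe_nonneg]
    refine ENNReal.ofReal_le_ofReal ?_
    rw [div_le_iff₀ (hr n), hxy]
    refine (window_sub_le h1).trans ?_
    have h3 : ‖y - x‖ ≤ r n := by rwa [← dist_eq_norm]
    have h4 : fderiv ℝ u x (y - x) ≤ ‖fderiv ℝ u x‖ * ‖y - x‖ :=
      (le_abs_self _).trans ((fderiv ℝ u x).le_opNorm _)
    have h5 := (le_abs_self _).trans h2
    have h6 := mul_le_mul_of_nonneg_left h3 (add_nonneg (norm_nonneg (fderiv ℝ u x)) ε.coe_nonneg)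
    linarith
  · rw [indicator_of_notMem (show x ∉ {x | t ≤ u x ∧ u x < t + h} from hx)]
    refine limsup_le_of_le (by isBoundedDefault) ?_
    rcases lt_or_ge (u x) t with hxt | hxt
    · filter_upwards [hsmall _ (hu.continuousAt.eventually_lt_const hxt)] with n hn
      obtain ⟨y, hy, hxy, hmax⟩ := exists_ballSup_eq hu (hr n).le x
      rw [hxy, window_eq_zero hh (hn y hy).le, window_eq_zero hh hxt.le]
      simp
    · have hxh : t + h ≤ u x := not_lt.1 fun hlt => hx ⟨hxt, hlt⟩
      refine Eventually.of_forall fun n => ?_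
      rw [window_eq hh hxh]
      refine (ENNReal.ofReal_eq_zero.2 ?_).le
      exact div_nonpos_of_nonpos_of_nonneg (sub_nonpos.2 window_le) (hr n).le

/-- The isoperimetric inequality for the level sets of `u` in integrated form. -/
lemma ofReal_sqrt_le_lintegral_norm_fderiv {u : EuclideanSpace ℝ (Fin 2) → ℝ}
    (hu : ContDiff ℝ 1 u) (hs : HasCompactSupport u) {t h : ℝ} (ht : 0 < t) (hh : 0 ≤ h) :
    ENNReal.ofReal (2 * h * Real.sqrt (Real.pi * (volume {x | t + h ≤ u x}).toReal)) ≤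
      ∫⁻ x in {x | t ≤ u x ∧ u x < t + h}, ENNReal.ofReal ‖fderiv ℝ u x‖ := by
  have huc := hu.continuous
  set r : ℕ → ℝ := fun n => 1 / ((n : ℝ) + 1) with hrdef
  have hr : ∀ n, 0 < r n := fun n => by positivity
  have hr1 : ∀ n, r n ≤ 1 := fun n => by
    rw [hrdef]
    exact div_le_one_of_le₀ (by simp) (by positivity)
  have hr0 : Tendsto r atTop (𝓝 0) := tendsto_one_div_add_atTop_nhds_zero_nat
  obtain ⟨C, hC⟩ := hu.lipschitzWith_of_hasCompactSupport hs one_ne_zero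
  have hKc : IsCompact (Metric.cthickening 1 (tsupport u)) := hs.cthickening
  have hmeas : Measurable fun x => window t h (u x) := by
    unfold window
    have := huc.measurable
    fun_prop
  have hbound := limsup_lintegral_le (μ := (volume : Measure (EuclideanSpace ℝ (Fin 2))))
    (f := fun n x => ENNReal.ofReal ((window t h (ballSup u (r n) x) - window t h (u x)) / r n))
    ((Metric.cthickening 1 (tsupport u)).indicator fun _ => (C : ENNReal))
    (fun n => by
      have := measurable_window_ballSup huc (fun s h0 => isCompact_superlevel huc hs h0) ht hh
        (hr n).le
      fun_prop)
    (fun n => ae_of_all _ fun x => by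
      obtain ⟨y, hy, hxy, hmax⟩ := exists_ballSup_eq huc (hr n).le x
      have h1 : u x ≤ u y := hmax x (Metric.mem_closedBall_self (hr n).le)
      have hyx : dist y x ≤ r n := hy
      simp only [hxy]
      by_cases hyt : u y ≤ t
      · rw [window_eq_zero hh hyt, window_eq_zero hh (h1.trans hyt)]
        simp
      · have hyK : y ∈ tsupport u := subset_tsupport u (by
          rw [Function.mem_support]
          linarith)
        have hxK : x ∈ Metric.cthickening 1 (tsupport u) :=
          Metric.mem_cthickening_of_dist_le x y 1 _ hyK (by
            rw [dist_comm]
            exact hyx.trans (hr1 n))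
        rw [indicator_of_mem hxK, ← ENNReal.ofReal_coe_nnreal]
        refine ENNReal.ofReal_le_ofReal ?_
        rw [div_le_iff₀ (hr n)]
        refine (window_sub_le h1).trans ?_
        have h2 := (le_abs_self _).trans (hC.dist_le_mul y x)
        exact h2.trans (mul_le_mul_of_nonneg_left hyx C.2))
    (by
      rw [lintegral_indicator_const hKc.measurableSet]
      exact ENNReal.mul_ne_top ENNReal.coe_ne_top hKc.measure_lt_top.ne)
  have hS : MeasurableSet {x | t ≤ u x ∧ u x < t + h} :=
    (measurableSet_le measurable_const huc.measurable).inter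
      (measurableSet_lt huc.measurable measurable_const)
  rw [← lintegral_indicator hS]
  refine le_trans ?_ (hbound.trans (lintegral_mono fun x =>
    limsup_window_diff_le huc hh (hu.differentiable one_ne_zero x) hr hr0))
  exact le_limsup_of_frequently_le
    (Frequently.of_forall fun n => ofReal_window_diff_le huc hs ht hh (hr n)) (by isBoundedDefault)

lemma sq_setIntegral_le {α : Type*} [MeasurableSpace α] {μ : Measure α} {S : Set α} {g : α → ℝ}
    (hS : μ S ≠ ⊤) (hg : IntegrableOn g S μ) (hg2 : IntegrableOn (fun x => g x ^ 2) S μ) :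
    (∫ x in S, g x ∂μ) ^ 2 ≤ (μ S).toReal * ∫ x in S, g x ^ 2 ∂μ := by
  have hd := discrim_le_zero (a := (μ S).toReal) (b := -2 * ∫ x in S, g x ∂μ)
    (c := ∫ x in S, g x ^ 2 ∂μ) (by
      intro x
      have h0 : 0 ≤ ∫ y in S, (x * x + -2 * x * g y + g y ^ 2) ∂μ :=
        integral_nonneg fun y => by
          simp only [Pi.zero_apply]
          nlinarith [sq_nonneg (x - g y)]
      have hc : IntegrableOn (fun _ => x * x) S μ := integrableOn_const hS
      have hl : IntegrableOn (fun y => -2 * x * g y) S μ := hg.const_mul _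
      have hcl : IntegrableOn (fun y => x * x + -2 * x * g y) S μ := hc.add hl
      rw [integral_add hcl hg2, integral_add hc hl, setIntegral_const,
        smul_eq_mul, measureReal_def, integral_const_mul] at h0
      linarith)
  rw [discrim] at hd
  linarith

lemma integrable_norm_fderiv_sq {u : EuclideanSpace ℝ (Fin 2) → ℝ}
    (hu : ContDiff ℝ 1 u) (hc : HasCompactSupport u) :
    Integrable fun x => ‖fderiv ℝ u x‖ ^ 2 := by
  have hs : HasCompactSupport fun x => ‖fderiv ℝ u x‖ * ‖fderiv ℝ u x‖ :=
    (hc.fderiv ℝ).norm.mul_right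
  simp_rw [← sq] at hs
  exact ((hu.continuous_fderiv one_ne_zero).norm.pow 2).integrable_of_hasCompactSupport hs

/-- The Dirichlet energy of `u` on its superlevel set at height `t`. -/
noncomputable def energyAbove (u : EuclideanSpace ℝ (Fin 2) → ℝ) (t : ℝ) : ℝ :=
  ∫ x in {x | t ≤ u x}, ‖fderiv ℝ u x‖ ^ 2

lemma four_pi_mul_sq_mul_volume_le {u : EuclideanSpace ℝ (Fin 2) → ℝ}
    (hu : ContDiff ℝ 1 u) (hc : HasCompactSupport u) {s t : ℝ} (hs : 0 < s) (hst : s ≤ t) :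
    4 * Real.pi * (t - s) ^ 2 * (volume {x | t ≤ u x}).toReal ≤
      ((volume {x | s ≤ u x}).toReal - (volume {x | t ≤ u x}).toReal)
        * (energyAbove u s - energyAbove u t) := by
  have huc := hu.continuous
  have hpi := Real.pi_pos
  have hDc : Continuous fun x => ‖fderiv ℝ u x‖ := (hu.continuous_fderiv one_ne_zero).norm
  have hDi : Integrable fun x => ‖fderiv ℝ u x‖ :=
    hDc.integrable_of_hasCompactSupport (hc.fderiv ℝ).norm
  have hDi2 := integrable_norm_fderiv_sq hu hc
  have h1 := ofReal_sqrt_le_lintegral_norm_fderiv hu hc hs (sub_nonneg.2 hst)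
  simp only [add_sub_cancel] at h1
  set S := {x | s ≤ u x ∧ u x < t} with hSdef
  have hcs := isCompact_superlevel huc hc hs
  have hct := isCompact_superlevel huc hc (hs.trans_le hst)
  have hsub : {x | t ≤ u x} ⊆ {x | s ≤ u x} := fun x hx => hst.trans hx
  have hSd : S = {x | s ≤ u x} \ {x | t ≤ u x} := by
    ext x
    simp [hSdef]
  have hSv : (volume S).toReal = (volume {x | s ≤ u x}).toReal - (volume {x | t ≤ u x}).toReal := by
    rw [hSd, measure_sdiff hsub hct.measurableSet.nullMeasurableSet hct.measure_lt_top.ne,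
      ENNReal.toReal_sub_of_le (measure_mono hsub) hcs.measure_lt_top.ne]
  have hSe : ∫ x in S, ‖fderiv ℝ u x‖ ^ 2 = energyAbove u s - energyAbove u t := by
    rw [hSd, setIntegral_sdiff hct.measurableSet hDi2.integrableOn hsub]
    rfl
  have hSt : volume S ≠ ⊤ := ne_top_of_le_ne_top hcs.measure_lt_top.ne
    (measure_mono fun x hx => hx.1)
  rw [← ofReal_integral_eq_lintegral_ofReal hDi.integrableOn (ae_of_all _ fun x => norm_nonneg _),
    ENNReal.ofReal_le_ofReal_iff (integral_nonneg fun x => norm_nonneg _)] at h1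
  have h2 := sq_setIntegral_le hSt hDi.integrableOn hDi2.integrableOn
  rw [hSv, hSe] at h2
  refine le_trans (le_of_eq ?_) ((pow_le_pow_left₀
    (mul_nonneg (mul_nonneg two_pos.le (sub_nonneg.2 hst)) (Real.sqrt_nonneg _)) h1 2).trans h2)
  rw [mul_pow, mul_pow, Real.sq_sqrt (by positivity)]
  ring

lemma integral_mul_exp_sq (κ b : ℝ) :
    ∫ t in (0 : ℝ)..b, 2 * κ * t * Real.exp (κ * t ^ 2) = Real.exp (κ * b ^ 2) - 1 := by
  have hd : ∀ t ∈ uIcc 0 b,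
      HasDerivAt (fun t => Real.exp (κ * t ^ 2)) (2 * κ * t * Real.exp (κ * t ^ 2)) t := by
    intro t _
    have h := ((hasDerivAt_pow 2 t).const_mul κ).exp
    convert h using 1
    push_cast
    ring
  rw [intervalIntegral.integral_eq_sub_of_hasDerivAt hd
    (Continuous.intervalIntegrable (by fun_prop) _ _)]
  simp

/-- The one-sided Trudinger-Moser inequality. -/
lemma lintegral_exp_sq_posPart_le {Ω : Set (EuclideanSpace ℝ (Fin 2))} (hΩ : volume Ω ≠ ⊤)
    {u : EuclideanSpace ℝ (Fin 2) → ℝ}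
    (hu : ContDiff ℝ 1 u) (hc : HasCompactSupport u) (hsupp : tsupport u ⊆ Ω)
    (hE : ∫ x, ‖fderiv ℝ u x‖ ^ 2 ≤ 1) :
    ∫⁻ x in Ω, ENNReal.ofReal (Real.exp (4 * Real.pi * max (u x) 0 ^ 2)) ≤
      volume Ω * ENNReal.ofReal (1 + moserConst) := by
  have huc := hu.continuous
  have hκ : 0 < 4 * Real.pi := by positivity
  set κ := 4 * Real.pi with hκdef
  have hDi2 := integrable_norm_fderiv_sq hu hc
  set V := (volume Ω).toReal with hV
  set m : ℝ → ℝ := fun t => (volume {x | t ≤ u x}).toReal with hm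
  have hfin : ∀ t, 0 < t → volume {x | t ≤ u x} ≠ ⊤ := fun t ht =>
    (isCompact_superlevel huc hc ht).measure_lt_top.ne
  have hmV : ∀ t, 0 < t → m t ≤ V := fun t ht => ENNReal.toReal_mono hΩ
    (measure_mono fun x (hx : t ≤ u x) => hsupp (subset_tsupport u (by
      rw [Function.mem_support]
      linarith)))
  have hmanti : AntitoneOn m (Ioi 0) := fun s hs t ht hst =>
    ENNReal.toReal_mono (hfin s hs) (measure_mono fun x hx => le_trans hst hx)
  have hDanti : Antitone (energyAbove u) := fun s t hst =>
    setIntegral_mono_set hDi2.integrableOn (ae_of_all _ fun x => by positivity)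
      (Eventually.of_forall fun x hx => le_trans hst hx)
  have hD0 : ∀ t, 0 ≤ energyAbove u t := fun t => integral_nonneg fun x => by positivity
  have hD1 : ∀ t, energyAbove u t ≤ 1 := fun t =>
    (setIntegral_le_integral hDi2 (ae_of_all _ fun x => by positivity)).trans hE
  set P : Set ℝ := {t | 0 < t ∧ 0 < m t} with hP
  set L : ℝ → ℝ := fun t => Real.log V - Real.log (m t) with hL
  have hL0 : ∀ t ∈ P, 0 ≤ L t := fun t ht =>
    sub_nonneg.2 (Real.log_le_log ht.2 (hmV t ht.1))
  have hslope : ∀ s ∈ P, ∀ t ∈ P, s ≤ t →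
      κ * (t - s) ^ 2 ≤ (L t - L s) * (energyAbove u s - energyAbove u t) := by
    intro s hs t ht hst
    have := mul_sq_le_log_mul_of_slope hκ.le hst
      (hmanti.mono fun x hx => hs.1.trans_le hx.1) (hDanti.antitoneOn _) ht.2
      (fun a ha b _ hab => four_pi_mul_sq_mul_volume_le hu hc (hs.1.trans_le ha.1) hab.le)
    simp only [hL]
    linarith
  have hzero : ∀ t ∈ P, κ * t ^ 2 ≤ L t * (1 - energyAbove u t) := by
    intro t ht
    have hlim : Tendsto (fun s => κ * (t - s) ^ 2) (𝓝[>] 0) (𝓝 (κ * t ^ 2)) := by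
      have : ContinuousAt (fun s : ℝ => κ * (t - s) ^ 2) 0 := by fun_prop
      simpa using this.tendsto.mono_left nhdsWithin_le_nhds
    refine le_of_tendsto hlim ?_
    filter_upwards [Ioo_mem_nhdsGT ht.1] with s hs
    have hsP : s ∈ P := ⟨hs.1, ht.2.trans_le (hmanti hs.1 ht.1 hs.2.le)⟩
    refine (hslope s hsP t ht hs.2.le).trans (mul_le_mul ?_ ?_ ?_ (hL0 t ht))
    · linarith [hL0 s hsP]
    · linarith [hD1 s]
    · linarith [hDanti hs.2.le]
  have hmain := lintegral_mul_exp_sub_le hκ (fun t ht => ht.1 : P ⊆ Ioi 0)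
    (fun s hs t ht hst => sub_le_sub_left (Real.log_le_log ht.2 (hmanti hs.1 ht.1 hst)) _)
    hL0 (fun t _ => hD0 t) (fun t _ => hD1 t) hslope hzero
  have hlayer := lintegral_comp_eq_lintegral_meas_le_mul (volume.restrict Ω)
    (f := fun x => max (u x) 0) (g := fun t => 2 * κ * t * Real.exp (κ * t ^ 2))
    (ae_of_all _ fun x => le_max_right _ _) (by fun_prop)
    (fun t _ => Continuous.intervalIntegrable (by fun_prop) _ _)
    ((ae_restrict_mem measurableSet_Ioi).mono fun t (ht : 0 < t) => by positivity)
  simp only [integral_mul_exp_sq] at hlayer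
  have hle : ∫⁻ x in Ω, ENNReal.ofReal (Real.exp (κ * max (u x) 0 ^ 2) - 1) ≤
      volume Ω * ENNReal.ofReal moserConst := by
    rw [hlayer]
    refine le_trans ?_ (mul_le_mul_right hmain _)
    rw [← lintegral_const_mul' _ _ hΩ, ← lintegral_indicator measurableSet_Ioi]
    refine lintegral_mono fun t => ?_
    by_cases ht : 0 < t
    · rw [indicator_of_mem (show t ∈ Ioi 0 from ht)]
      have h1 : (volume.restrict Ω) {x | t ≤ max (u x) 0} ≤ ENNReal.ofReal (m t) := by
        rw [hm, ENNReal.ofReal_toReal (hfin t ht)]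
        refine (Measure.restrict_le_self _).trans (measure_mono fun x hx => ?_)
        exact (le_max_iff.1 hx).resolve_right (not_le.2 ht)
      refine (mul_le_mul_left h1 _).trans ?_
      by_cases hmt : 0 < m t
      · rw [indicator_of_mem (show t ∈ P from ⟨ht, hmt⟩), ← ENNReal.ofReal_toReal hΩ, ← hV,
          ← ENNReal.ofReal_mul hmt.le, ← ENNReal.ofReal_mul ENNReal.toReal_nonneg]
        refine le_of_eq (congrArg _ ?_)
        have hVpos : 0 < V := hmt.trans_le (hmV t ht)
        rw [← hV, Real.exp_sub, Real.exp_sub, Real.exp_log hVpos, Real.exp_log hmt]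
        field_simp
      · rw [le_antisymm (not_lt.1 hmt) ENNReal.toReal_nonneg]
        simp
    · rw [indicator_of_notMem (show t ∉ Ioi 0 from ht)]
      exact zero_le
  have hsplit : ∀ x, ENNReal.ofReal (Real.exp (κ * max (u x) 0 ^ 2)) =
      1 + ENNReal.ofReal (Real.exp (κ * max (u x) 0 ^ 2) - 1) := fun x => by
    rw [← ENNReal.ofReal_one, ← ENNReal.ofReal_add zero_le_one
      (sub_nonneg.2 (Real.one_le_exp (by positivity)))]
    congr 1
    ring
  have hM0 : 0 ≤ moserConst := tsum_nonneg fun k => by positivity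
  simp_rw [hsplit]
  rw [lintegral_add_left measurable_const, setLIntegral_const, one_mul,
    ENNReal.ofReal_add zero_le_one hM0, ENNReal.ofReal_one, mul_add, mul_one]
  gcongr

end

/-- The Trudinger–Moser inequality: there is a constant `C > 0` such that for
every bounded open `Ω ⊆ ℝ²`, every `0 < α ≤ 4π` and every smooth compactly
supported `u` with support in `Ω` and `∫ |∇u|² ≤ 1`, one has
`∫_Ω exp(α u²) ≤ C·|Ω|`. -/
theorem trudinger_moser_inequality :
    ∃ C : ℝ, 0 < C ∧
      ∀ (Ω : Set (EuclideanSpace ℝ (Fin 2))), IsOpen Ω → Bornology.IsBounded Ω →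
      ∀ α : ℝ, 0 < α → α ≤ 4 * Real.pi →
      ∀ u : EuclideanSpace ℝ (Fin 2) → ℝ, ContDiff ℝ (⊤ : ℕ∞) u →
        HasCompactSupport u → tsupport u ⊆ Ω →
        (∫ x, ‖fderiv ℝ u x‖ ^ 2) ≤ 1 →
        (∫ x in Ω, Real.exp (α * u x ^ 2)) ≤ C * (volume Ω).toReal := by
  have hM0 : 0 ≤ moserConst := tsum_nonneg fun k => by positivity
  refine ⟨2 * (1 + moserConst), by positivity, ?_⟩
  intro Ω _ hb α _ hα u hu hc hsupp hE
  have hΩ : volume Ω ≠ ⊤ := hb.measure_lt_top.ne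
  have hu1 : ContDiff ℝ 1 u := hu.of_le (by exact_mod_cast le_top)
  have h1 := lintegral_exp_sq_posPart_le hΩ hu1 hc hsupp hE
  have h2 := lintegral_exp_sq_posPart_le (u := -u) hΩ hu1.neg hc.neg
    (by rwa [tsupport, Function.support_neg]) (by simpa [fderiv_neg] using hE)
  have huc := hu.continuous
  rw [integral_eq_lintegral_of_nonneg_ae (ae_of_all _ fun x => (Real.exp_nonneg _))
    (Continuous.aestronglyMeasurable (by fun_prop))]
  have h3 : ∫⁻ x in Ω, ENNReal.ofReal (Real.exp (α * u x ^ 2)) ≤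
      volume Ω * ENNReal.ofReal (2 * (1 + moserConst)) := by
    rw [two_mul, ENNReal.ofReal_add (by positivity) (by positivity), mul_add]
    refine le_trans ?_ (add_le_add h1 h2)
    rw [← lintegral_add_left (by fun_prop)]
    refine lintegral_mono fun x => ?_
    rw [← ENNReal.ofReal_add (Real.exp_nonneg _) (Real.exp_nonneg _)]
    refine ENNReal.ofReal_le_ofReal ?_
    have hle : Real.exp (α * u x ^ 2) ≤ Real.exp (4 * Real.pi * u x ^ 2) := by gcongr
    have hp := Real.exp_nonneg (4 * Real.pi * max (u x) 0 ^ 2)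
    have hn := Real.exp_nonneg (4 * Real.pi * max ((-u) x) 0 ^ 2)
    rcases le_total 0 (u x) with h | h
    · rw [max_eq_left h]
      linarith
    · have : max ((-u) x) 0 = -u x := max_eq_left (neg_nonneg.2 h)
      rw [this] at hn ⊢
      rw [neg_sq]
      linarith
  have h4 := ENNReal.toReal_mono (ENNReal.mul_ne_top hΩ ENNReal.ofReal_ne_top) h3
  rwa [ENNReal.toReal_mul, ENNReal.toReal_ofReal (by positivity), mul_comm] at h4
end
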